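/- Let K be the A_n-crystal K(c) with source s, and let a in Z^n satisfy 0<=a<=c. Then every operator in the string S_{n,n}^{a_n} S_{n,n-1}^{a_{n-1}} ... S_{n,1}^{a_1} acts when this string is applied to s (so the principal vertex v[a] is well-defined), and the strings commute on the principal lattice: for any k,k' with a+1_k+1_{k'}<=c (where 1_k denotes the k-th unit vector), S_{n,k}(S_{n,k'}(v[a]))=S_{n,k'}(S_{n,k}(v[a])); consequently v[a+1_k]=S_{n,k}(v[a]) whenever a+1_k<=c. -/

import Mathlib

open Classical

noncomputable section

/-- Iterate a partial operator `k` times. -/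
def optIter {V : Type} (f : V → Option V) : ℕ → V → Option V
  | 0, v => some v
  | k + 1, v => (f v).bind (optIter f k)

/-- A vertex type together with, for every natural number (color) `i`,
a partial operator whose graph is the set of `i`-edges. -/
structure PreGraph where
  V : Type
  F : ℕ → V → Option V

namespace PreGraph

/-- Partial inverse operator of color `i`. -/
def Finv (K : PreGraph) (i : ℕ) (v : K.V) : Option K.V :=
  if h : ∃ u, K.F i u = some v then some h.choose else none

/-- Number of edges of the maximal `i`-colored path beginning at `v`. -/
def h (K : PreGraph) (i : ℕ) (v : K.V) : ℕ :=
  sSup {k | (optIter (K.F i) k v).isSome = true}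

/-- Number of edges of the maximal `i`-colored path ending at `v`. -/
def t (K : PreGraph) (i : ℕ) (v : K.V) : ℕ :=
  sSup {k | ∃ u, optIter (K.F i) k u = some v}

/-- One (undirected) step along an edge of any color. -/
def Step (K : PreGraph) (u v : K.V) : Prop :=
  ∃ i, K.F i u = some v ∨ K.F i v = some u

/-- Weak connectivity. -/
def Connected (K : PreGraph) : Prop :=
  ∀ u v : K.V, Relation.ReflTransGen K.Step u v

/-- All edges have colors in `C`. -/
def ColorsIn (K : PreGraph) (C : Set ℕ) : Prop :=
  ∀ i ∉ C, ∀ v, K.F i v = none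

end PreGraph

/-- `s` has no incoming edges. -/
def IsSource (K : PreGraph) (s : K.V) : Prop := ∀ i u, K.F i u ≠ some s

/-- `tv` has no outgoing edges. -/
def IsSink (K : PreGraph) (tv : K.V) : Prop := ∀ i, K.F i tv = none

/-- `K` is a (finite) colored graph with colors in `C` satisfying axiom (A1):
every connected monochromatic subgraph is a finite directed path. -/
def IsColored (K : PreGraph) (C : Set ℕ) : Prop :=
  Finite K.V ∧ K.ColorsIn C ∧
  (∀ (i : ℕ) (u u' v : K.V), K.F i u = some v → K.F i u' = some v → u = u') ∧
  (∀ (i : ℕ) (v : K.V) (k : ℕ), 0 < k → optIter (K.F i) k v ≠ some v)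

/-- `|i - j| = 1`. -/
def Neighb (i j : ℕ) : Prop := i + 1 = j ∨ j + 1 = i

/-- `|i - j| ≥ 2`. -/
def Far (i j : ℕ) : Prop := i + 2 ≤ j ∨ j + 2 ≤ i

instance (i j : ℕ) : Decidable (Neighb i j) := by unfold Neighb; infer_instance
instance (i j : ℕ) : Decidable (Far i j) := by unfold Far; infer_instance

/-- Axiom (A2) for the ordered pair of distinct colors `(i, j)`. -/
def A2at (K : PreGraph) (i j : ℕ) : Prop :=
  (∀ u v, K.F i u = some v →
    K.t j v ≤ K.t j u ∧ K.h j u ≤ K.h j v ∧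
    ((K.h j u : ℤ) - (K.t j u : ℤ)) - ((K.h j v : ℤ) - (K.t j v : ℤ)) =
      (if Neighb i j then (-1 : ℤ) else 0)) ∧
  (∀ u v w, K.F i u = some v → K.F i v = some w →
    2 * K.h j v ≤ K.h j u + K.h j w)

/-- Axiom (A3) for neighboring colors `i, j`. -/
def A3at (K : PreGraph) (i j : ℕ) : Prop :=
  (∀ u v v', K.F i u = some v → K.F j u = some v' →
    K.h j v = K.h j u →
    ((K.h i v' : ℤ) - (K.h i u : ℤ) = 1 ∧ ∃ w, K.F j v = some w ∧ K.F i v' = some w)) ∧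
  (∀ u u' v, K.F i u = some v → K.F j u' = some v →
    (K.h j v : ℤ) - (K.h j u : ℤ) = 1 →
    (K.h i v = K.h i u' ∧ ∃ w, K.F j w = some u ∧ K.F i w = some u'))

/-- Axiom (A4) (Verma relations) for neighboring colors `i, j`. -/
def A4at (K : PreGraph) (i j : ℕ) : Prop :=
  (∀ u v v', K.F i u = some v → K.F j u = some v' →
    (K.h j v : ℤ) - (K.h j u : ℤ) = 1 → (K.h i v' : ℤ) - (K.h i u : ℤ) = 1 →
    ∃ w, (((K.F i u).bind (K.F j)).bind (K.F j)).bind (K.F i) = some w ∧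
         (((K.F j u).bind (K.F i)).bind (K.F i)).bind (K.F j) = some w) ∧
  (∀ u u' v, K.F i u = some v → K.F j u' = some v →
    K.h j v = K.h j u → K.h i v = K.h i u' →
    ∃ w, (((K.Finv i v).bind (K.Finv j)).bind (K.Finv j)).bind (K.Finv i) = some w ∧
         (((K.Finv j v).bind (K.Finv i)).bind (K.Finv i)).bind (K.Finv j) = some w)

/-- Axiom (A5) for colors `i, j` at distance at least 2. -/
def A5at (K : PreGraph) (i j : ℕ) : Prop :=
  ∀ Fi ∈ ({K.F i, K.Finv i} : Set (K.V → Option K.V)),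
  ∀ Fj ∈ ({K.F j, K.Finv j} : Set (K.V → Option K.V)),
  ∀ v, (Fi v).isSome → (Fj v).isSome →
    ∃ w, (Fi v).bind Fj = some w ∧ (Fj v).bind Fi = some w

/-- `K` is a regular crystal of type A on the color set `C`
(an `A_{|C|}`-crystal when `C` is an integer interval). -/
def IsCrystalOn (K : PreGraph) (C : Set ℕ) : Prop :=
  IsColored K C ∧ K.Connected ∧
  (∀ i ∈ C, ∀ j ∈ C, i ≠ j → A2at K i j) ∧
  (∀ i ∈ C, ∀ j ∈ C, Neighb i j → A3at K i j ∧ A4at K i j) ∧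
  (∀ i ∈ C, ∀ j ∈ C, Far i j → A5at K i j)

/-- `K` is an `A_n`-crystal (colors `1, …, n`). -/
def IsACrystal (n : ℕ) (K : PreGraph) : Prop := IsCrystalOn K (Set.Icc 1 n)

/-- Apply a list of operators, head first. -/
def applyStr (K : PreGraph) : List ℕ → K.V → Option K.V
  | [], v => some v
  | i :: L, v => (K.F i v).bind (applyStr K L)

/-- The string `w_{m,k,j} = F_{o+j} F_{o+j+1} ⋯ F_{o+j+k-1}` (rightmost applied
first, i.e. head of the list applied first) for a crystal with colors `o+1, …, o+m`. -/
def wStr (o k j : ℕ) : List ℕ := (List.range k).map (fun m => o + j + k - 1 - m)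

/-- The string `S_{m,k} = w_{m,k,m-k+1} ⋯ w_{m,k,2} w_{m,k,1}` for a crystal with
colors `o+1, …, o+m`. -/
def SStr (o m k : ℕ) : List ℕ :=
  (List.range (m - k + 1)).flatMap fun jm => wStr o k (jm + 1)

/-- The string `S_{m,m}^{a_{o+m}} ⋯ S_{m,1}^{a_{o+1}}` for a crystal with colors
`o+1, …, o+m`, defining the principal vertex with coordinates `a`. -/
def prinStr (o m : ℕ) (a : ℕ → ℕ) : List ℕ :=
  (List.range m).flatMap fun km => (List.replicate (a (o + km + 1)) (SStr o m (km + 1))).flatten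

def prinOpt (K : PreGraph) (o m : ℕ) (s : K.V) (a : ℕ → ℕ) : Option K.V :=
  applyStr K (prinStr o m a) s

/-- `p` is the principal vertex with coordinates `a` of the crystal `K` with colors
`o+1, …, o+m` and source `s`. -/
def IsPrin (K : PreGraph) (o m : ℕ) (s : K.V) (a : ℕ → ℕ) (p : K.V) : Prop :=
  prinOpt K o m s a = some p

/-- The principal lattice of an `A_n`-crystal with source `s` and parameter `c`. -/
def PrinLat (K : PreGraph) (n : ℕ) (s : K.V) (c : ℕ → ℕ) : Set K.V :=
  {p | ∃ a : ℕ → ℕ, (∀ i, 1 ≤ i → i ≤ n → a i ≤ c i) ∧ IsPrin K 0 n s a p}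

/-- One undirected step along an edge with color in `I`. -/
def stepOn (K : PreGraph) (I : Set ℕ) (u v : K.V) : Prop :=
  ∃ i ∈ I, K.F i u = some v ∨ K.F i v = some u

/-- `u` lies in the same `I`-colored component as `v`. -/
def inComp (K : PreGraph) (I : Set ℕ) (v u : K.V) : Prop :=
  Relation.ReflTransGen (stepOn K I) v u

/-- The subcrystal of `K` with color set `I` containing `v` (the maximal connected
subgraph through `v` using only colors in `I`). -/
def PreGraph.sub (K : PreGraph) (I : Set ℕ) (v : K.V) : PreGraph where
  V := {u : K.V // inComp K I v u}
  F := fun i u =>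
    if hi : i ∈ I then
      (K.F i u.1).pbind fun w hw =>
        some ⟨w, Relation.ReflTransGen.tail u.2 ⟨i, hi, Or.inl (Option.mem_def.mp hw)⟩⟩
    else none

/-- Directed reachability. -/
def dirReach (K : PreGraph) (u v : K.V) : Prop :=
  Relation.ReflTransGen (fun a b => ∃ i, K.F i a = some b) u v

/-- The interval of `K` from `p` to `q`: the subgraph formed by all vertices and
edges lying on directed paths from `p` to `q`. -/
def PreGraph.interval (K : PreGraph) (p q : K.V) : PreGraph where
  V := {w : K.V // dirReach K p w ∧ dirReach K w q}
  F := fun i u =>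
    (K.F i u.1).pbind fun w _ =>
      if hw : dirReach K p w ∧ dirReach K w q then some ⟨w, hw⟩ else none

/-- The symmetric extract: restriction to self-complementary vertices,
with `ibar`-edges given by `chain i`. -/
def extract (K : PreGraph) (chain : ℕ → K.V → Option K.V) (σ : K.V → K.V) : PreGraph where
  V := {v : K.V // σ v = v}
  F := fun i u =>
    (chain i u.1).pbind fun w _ => if hw : σ w = w then some ⟨w, hw⟩ else none

/-- The operator chain for the color `ibar` of the symmetric extract of a
symmetric `A_{2n-1}`-crystal. -/
def chainB (K : PreGraph) (n : ℕ) (i : ℕ) (u : K.V) : Option K.V :=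
  if 1 ≤ i ∧ i ≤ n then
    (if i = n then K.F n u else (K.F i u).bind (K.F (2 * n - i)))
  else none

/-- The operator chain for the color `ibar` of the symmetric extract of a
symmetric `A_{2n}`-crystal. -/
def chainC (K : PreGraph) (n : ℕ) (i : ℕ) (u : K.V) : Option K.V :=
  if 1 ≤ i ∧ i ≤ n then
    (if i = n then (((K.F n u).bind (K.F (n + 1))).bind (K.F (n + 1))).bind (K.F n)
     else (K.F i u).bind (K.F (2 * n + 1 - i)))
  else none

/-- Symmetric extract from a symmetric `A_{2n-1}`-crystal. -/
def extractB (K : PreGraph) (n : ℕ) (σ : K.V → K.V) : PreGraph := extract K (chainB K n) σ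

/-- Symmetric extract from a symmetric `A_{2n}`-crystal. -/
def extractC (K : PreGraph) (n : ℕ) (σ : K.V → K.V) : PreGraph := extract K (chainC K n) σ

/-- Admissibility of a six-tuple `(x', y, x''; y', x, y'')` in the worm model. -/
def WormOK (g1 g2 : ℕ) : ℤ × ℤ × ℤ × ℤ × ℤ × ℤ → Prop
  | (x', y, x'', y', x, y'') =>
    (0 ≤ x' ∧ x' ≤ 2 * (g1 : ℤ)) ∧ (0 ≤ x'' ∧ x'' ≤ 2 * (g1 : ℤ)) ∧
    (0 ≤ x ∧ x ≤ 2 * (g1 : ℤ)) ∧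
    (0 ≤ y' ∧ y' ≤ (g2 : ℤ)) ∧ (0 ≤ y'' ∧ y'' ≤ (g2 : ℤ)) ∧ (0 ≤ y ∧ y ≤ (g2 : ℤ)) ∧
    (2 ∣ x') ∧ (2 ∣ x'') ∧ (y' ≤ y ∧ y ≤ y'') ∧ (x' ≤ x ∧ x ≤ x'') ∧
    (y' < y → x' = x) ∧ (y < y'' → x = x'')

/-- The candidate image of a worm under the operator `1tilde`. -/
def worm1 : ℤ × ℤ × ℤ × ℤ × ℤ × ℤ → ℤ × ℤ × ℤ × ℤ × ℤ × ℤ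
  | (x', y, x'', y', x, y'') =>
    if 2 * x > x' + x'' then (x' + 2, y, x'', y', x, y'')
    else if x = x' ∧ x' = x'' ∧ y < y'' then (x', y + 1, x'', y', x, y'')
    else (x', y, x'' + 2, y', x, y'')

/-- The candidate image of a worm under the operator `2tilde`. -/
def worm2 : ℤ × ℤ × ℤ × ℤ × ℤ × ℤ → ℤ × ℤ × ℤ × ℤ × ℤ × ℤ
  | (x', y, x'', y', x, y'') =>
    if 2 * y > y' + y'' then (x', y, x'', y' + 1, x, y'')
    else if y' = y ∧ y = y'' ∧ x < x'' then (x', y, x'', y', x + 1, y'')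
    else (x', y, x'', y', x, y'' + 1)

/-- The worm graph `W(g1, g2)`, with colors `1 = 1tilde` and `2 = 2tilde`. -/
def WormGraph (g1 g2 : ℕ) : PreGraph where
  V := {w : ℤ × ℤ × ℤ × ℤ × ℤ × ℤ // WormOK g1 g2 w}
  F := fun i u =>
    if i = 1 then
      (if h1 : WormOK g1 g2 (worm1 u.1) then some ⟨worm1 u.1, h1⟩ else none)
    else if i = 2 then
      (if h2 : WormOK g1 g2 (worm2 u.1) then some ⟨worm2 u.1, h2⟩ else none)
    else none

/-- Isomorphism of colored graphs, renaming colors via `φ`. -/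
def IsoVia (K L : PreGraph) (φ : ℕ → ℕ) : Prop :=
  ∃ e : K.V ≃ L.V, ∀ i u v, K.F i u = some v ↔ L.F (φ i) (e u) = some (e v)

/-- The Cartesian product of an `i`-path of length `p` and a `j`-path of length `q`. -/
def boxGraph (i j p q : ℕ) : PreGraph where
  V := Fin (p + 1) × Fin (q + 1)
  F := fun s u =>
    if s = i then
      (if h : (u.1 : ℕ) < p then some (⟨(u.1 : ℕ) + 1, by omega⟩, u.2) else none)
    else if s = j then
      (if h : (u.2 : ℕ) < q then some (u.1, ⟨(u.2 : ℕ) + 1, by omega⟩) else none)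
    else none

/-- `B_n`-crystal: components with colors `n-1, n` are worm graphs,
with color `n-1` corresponding to `1tilde` and `n` to `2tilde`. -/
def IsBCrystal (n : ℕ) (B : PreGraph) : Prop :=
  IsColored B (Set.Icc 1 n) ∧ B.Connected ∧
  (∀ i ∈ Set.Icc 1 n, ∀ j ∈ Set.Icc 1 n, Far i j → A5at B i j) ∧
  (∀ i j, 1 ≤ i → i < n → 1 ≤ j → j < n → Neighb i j →
    ∀ v : B.V, IsCrystalOn (B.sub {i, j} v) {i, j}) ∧
  (∀ v : B.V, ∃ g1 g2 : ℕ,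
    IsoVia (B.sub ({n - 1, n} : Set ℕ) v) (WormGraph g1 g2)
      (fun x => if x = n - 1 then 1 else if x = n then 2 else 0))

/-- `C_n`-crystal: components with colors `n-1, n` are worm graphs,
with color `n-1` corresponding to `2tilde` and `n` to `1tilde`. -/
def IsCCrystal (n : ℕ) (B : PreGraph) : Prop :=
  IsColored B (Set.Icc 1 n) ∧ B.Connected ∧
  (∀ i ∈ Set.Icc 1 n, ∀ j ∈ Set.Icc 1 n, Far i j → A5at B i j) ∧
  (∀ i j, 1 ≤ i → i < n → 1 ≤ j → j < n → Neighb i j →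
    ∀ v : B.V, IsCrystalOn (B.sub {i, j} v) {i, j}) ∧
  (∀ v : B.V, ∃ g1 g2 : ℕ,
    IsoVia (B.sub ({n - 1, n} : Set ℕ) v) (WormGraph g1 g2)
      (fun x => if x = n - 1 then 2 else if x = n then 1 else 0))

/-! ### The crossing model -/

/-- `(k, i, j)` is a node `v_i^k(j)` of the supporting graph `G` for rank `n`. -/
def isNode (n k i j : ℕ) : Prop :=
  1 ≤ j ∧ j ≤ i ∧ i ≤ n ∧ i - j + 1 ≤ k ∧ k ≤ n - j + 1

instance (n k i j : ℕ) : Decidable (isNode n k i j) := by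
  unfold isNode; infer_instance

/-- Extension of a function on the nodes of `G` to the extended supporting graph:
extra nodes from which `G^k` is reachable get value `c k`, the others get `0`. -/
def fext (n : ℕ) (c : ℕ → ℕ) (f : ℕ × ℕ × ℕ → ℤ) (k i j : ℕ) : ℤ :=
  if isNode n k i j then f (k, i, j)
  else if j ≤ n - k + 1 then (c k : ℤ) else 0

/-- The slack at the node `v_i^k(j)`. -/
def epsN (n : ℕ) (c : ℕ → ℕ) (f : ℕ × ℕ × ℕ → ℤ) (k i j : ℕ) : ℤ :=
  (fext n c f k (i - 1) (j - 1) - fext n c f k i j) -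
    (fext n c f k i (j - 1) - fext n c f k (i + 1) j)

/-- The total slack at the multinode `V_i(j)`. -/
def epsTot (n : ℕ) (c : ℕ → ℕ) (f : ℕ × ℕ × ℕ → ℤ) (i j : ℕ) : ℤ :=
  ∑ k ∈ Finset.Icc (i - j + 1) (n - j + 1), epsN n c f k i j

/-- The reduced slack at the multinode `V_i(j)`. -/
def teps (n : ℕ) (c : ℕ → ℕ) (f : ℕ × ℕ × ℕ → ℤ) (i j : ℕ) : ℤ :=
  if hj : (Finset.Icc 1 j).Nonempty then
    max 0 ((Finset.Icc 1 j).inf' hj fun p => ∑ q ∈ Finset.Icc p j, epsTot n c f i q)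
  else 0

/-- `k0` satisfies the switch condition in the multinode `V_i(j)`. -/
def switchCond (n : ℕ) (f : ℕ × ℕ × ℕ → ℤ) (i j k0 : ℕ) : Prop :=
  i - j + 1 ≤ k0 ∧ k0 ≤ n - j + 1 ∧
  (∀ k, i - j + 1 ≤ k → k < k0 → isNode n k (i + 1) (j + 1) →
    f (k, i, j) = f (k, i + 1, j + 1)) ∧
  (∀ k, k0 < k → k ≤ n - j + 1 → isNode n k (i + 1) j →
    f (k, i + 1, j) = f (k, i, j))

/-- The switch-node (first node with the switch property) of the multinode `V_i(j)`. -/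
def switchNode (n : ℕ) (f : ℕ × ℕ × ℕ → ℤ) (i j : ℕ) : ℕ :=
  sInf {k0 | switchCond n f i j k0}

/-- Feasible functions of the crossing model (normalized to vanish off the nodes). -/
def Feasible (n : ℕ) (c : ℕ → ℕ) (f : ℕ × ℕ × ℕ → ℤ) : Prop :=
  (∀ k i j, ¬ isNode n k i j → f (k, i, j) = 0) ∧
  (∀ k i j, isNode n k i j → isNode n k (i - 1) j → f (k, i - 1, j) ≤ f (k, i, j)) ∧
  (∀ k i j, isNode n k i j → isNode n k (i + 1) (j + 1) → f (k, i + 1, j + 1) ≤ f (k, i, j)) ∧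
  (∀ k i j, isNode n k i j → 0 ≤ f (k, i, j) ∧ f (k, i, j) ≤ (c k : ℤ)) ∧
  (∀ i j, 1 ≤ j → j ≤ i → i ≤ n → ∃ k0, switchCond n f i j k0)

/-- Increase `f` by one at the node `(k, i, j)`. -/
def bump (f : ℕ × ℕ × ℕ → ℤ) (k i j : ℕ) : ℕ × ℕ × ℕ → ℤ :=
  fun x => if x = (k, i, j) then f x + 1 else f x

/-- The crossing-model graph `Kscr(c)`: vertices are the feasible functions, and
the move `φ_i` increases `f` by one at the switch-node of the active multinode. -/
def Kscr (n : ℕ) (c : ℕ → ℕ) : PreGraph where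
  V := {f : ℕ × ℕ × ℕ → ℤ // Feasible n c f}
  F := fun i f =>
    if 1 ≤ i ∧ i ≤ n ∧ ∃ j, 1 ≤ j ∧ j ≤ i ∧ 0 < teps n c f.1 i j then
      (let j := sSup {j | 1 ≤ j ∧ j ≤ i ∧ 0 < teps n c f.1 i j}
       let g := bump f.1 (switchNode n f.1 i j) i j
       if hg : Feasible n c g then some ⟨g, hg⟩ else none)
    else none

/-- The function `f_{a,D}` of the crossing model. -/
def faD (n : ℕ) (a : ℕ → ℕ) (D : ℕ → ℤ) : ℕ × ℕ × ℕ → ℤ := fun x =>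
  if isNode n x.1 x.2.1 x.2.2 then
    (if x.2.1 - x.2.2 + 1 = x.1 then (a x.1 : ℤ) else (a x.1 : ℤ) + min (D (x.1 - 1)) 0) +
    (if x.2.2 ≤ n - x.1 then max (D x.1) 0 else 0)
  else 0

/-! ### Descriptions of self-complementary vertices -/

/-- `(a1, a2, δ, l)` is the description of a self-complementary vertex `v` of a
symmetric `A_3`-crystal `K` with source `s` and parameter `c`. -/
def IsDescB (K : PreGraph) (s : K.V) (c : ℕ → ℕ) (v : K.V) (q : ℕ × ℕ × ℤ × ℕ) : Prop :=
  q.2.2.2 = K.t 2 v ∧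
  ∃ (a : ℕ → ℕ) (pa : K.V),
    a 1 = q.1 ∧ a 2 = q.2.1 ∧ a 3 = ((q.1 : ℤ) + max q.2.2.1 0).toNat ∧
    (∀ i, 1 ≤ i → i ≤ 3 → a i ≤ c i) ∧
    IsPrin K 0 3 s a pa ∧ inComp K (Set.Icc 1 2) pa v ∧
    0 ≤ (q.2.1 : ℤ) + q.2.2.1 ∧ 0 ≤ (a 3 : ℤ) - q.2.2.1 ∧
    ∃ s' : (K.sub (Set.Icc 1 2) pa).V, IsSource (K.sub (Set.Icc 1 2) pa) s' ∧
    ∃ z : (K.sub (Set.Icc 1 2) pa).V,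
      IsPrin (K.sub (Set.Icc 1 2) pa) 0 2 s'
        (fun i => if i = 1 then ((q.2.1 : ℤ) + q.2.2.1).toNat else ((a 3 : ℤ) - q.2.2.1).toNat) z ∧
      inComp K ({2} : Set ℕ) z.1 v

/-- The polytope of descriptions for a symmetric `A_3`-crystal with parameter `(c1, c2, c1)`. -/
def QuadB (c1 c2 : ℕ) : Set (ℕ × ℕ × ℤ × ℕ) :=
  {q | q.1 ≤ c1 ∧ q.2.1 ≤ c2 ∧ -(q.2.1 : ℤ) ≤ q.2.2.1 ∧ (q.2.1 : ℤ) - (c2 : ℤ) ≤ q.2.2.1 ∧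
       q.2.2.1 ≤ (c1 : ℤ) - (q.1 : ℤ) ∧ (q.2.2.2 : ℤ) ≤ (c2 : ℤ) + 2 * q.2.2.1}

/-- The worm associated to the description `(a1, a2, δ, l)`. -/
def wtupleB (a1 a2 : ℕ) (δ : ℤ) (l : ℕ) : ℤ × ℤ × ℤ × ℤ × ℤ × ℤ :=
  let a3 : ℤ := (a1 : ℤ) + max δ 0
  let tr : ℤ × ℤ × ℤ :=
    if 0 ≤ δ then
      if (l : ℤ) ≤ (a2 : ℤ) then ((l : ℤ), 2 * (a1 : ℤ), (a2 : ℤ))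
      else if (l : ℤ) ≤ (a2 : ℤ) + 2 * δ then
        ((a2 : ℤ), 2 * (a1 : ℤ) + (l : ℤ) - (a2 : ℤ), (a2 : ℤ))
      else ((a2 : ℤ), 2 * a3, (l : ℤ) - 2 * δ)
    else
      if (l : ℤ) ≤ (a2 : ℤ) + δ then ((l : ℤ), 2 * (a1 : ℤ), (a2 : ℤ) - δ)
      else ((a2 : ℤ) + δ, 2 * (a1 : ℤ), (l : ℤ) - 2 * δ)
  (2 * (a1 : ℤ), (a2 : ℤ), 2 * a3, tr.1, tr.2.1, tr.2.2)

def wtQ (q : ℕ × ℕ × ℤ × ℕ) : ℤ × ℤ × ℤ × ℤ × ℤ × ℤ :=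
  wtupleB q.1 q.2.1 q.2.2.1 q.2.2.2

/-- The string `(F_2 F_3)^r (F_3 F_2)^r` (rightmost applied first). -/
def diagStr (r : ℕ) : List ℕ :=
  (List.replicate r ([2, 3] : List ℕ)).flatten ++ (List.replicate r ([3, 2] : List ℕ)).flatten

/-- `(a1, a2, δ, ρ)` is the description of a self-complementary vertex `v` of a
symmetric `A_4`-crystal `K` with source `s` and parameter `c`. -/
def IsDescC (K : PreGraph) (s : K.V) (c : ℕ → ℕ) (v : K.V) (q : ℕ × ℕ × ℤ × ℕ) : Prop :=
  ∃ (a : ℕ → ℕ) (pa : K.V),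
    a 1 = q.1 ∧ a 2 = q.2.1 ∧ a 3 = ((q.2.1 : ℤ) + min q.2.2.1 0).toNat ∧
    a 4 = ((q.1 : ℤ) + max q.2.2.1 0).toNat ∧
    (∀ i, 1 ≤ i → i ≤ 4 → a i ≤ c i) ∧
    IsPrin K 0 4 s a pa ∧ inComp K (Set.Icc 1 3) pa v ∧
    0 ≤ (q.2.1 : ℤ) + q.2.2.1 ∧ 0 ≤ (a 4 : ℤ) - q.2.2.1 ∧
    (∃ s' : (K.sub (Set.Icc 1 3) pa).V, IsSource (K.sub (Set.Icc 1 3) pa) s' ∧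
     ∃ z : (K.sub (Set.Icc 1 3) pa).V,
       IsPrin (K.sub (Set.Icc 1 3) pa) 0 3 s'
         (fun i => if i = 1 then ((q.2.1 : ℤ) + q.2.2.1).toNat
                   else if i = 2 then a 3 else ((a 4 : ℤ) - q.2.2.1).toNat) z ∧
       inComp K (Set.Icc 2 3) z.1 v) ∧
    (∃ stil : (K.sub (Set.Icc 2 3) v).V, IsSource (K.sub (Set.Icc 2 3) v) stil ∧
       applyStr (K.sub (Set.Icc 2 3) v) (diagStr q.2.2.2) stil =
         some ⟨v, Relation.ReflTransGen.refl⟩)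

/-- The polytope of descriptions for a symmetric `A_4`-crystal with parameter
`(c1, c2, c2, c1)`. -/
def QuadC (c1 c2 : ℕ) : Set (ℕ × ℕ × ℤ × ℕ) :=
  {q | q.1 ≤ c1 ∧ q.2.1 ≤ c2 ∧ -(q.2.1 : ℤ) ≤ q.2.2.1 ∧
       q.2.2.1 ≤ (c1 : ℤ) - (q.1 : ℤ) ∧ (q.2.2.2 : ℤ) ≤ (c2 : ℤ) + q.2.2.1}

end

namespace PrincipalLattice

/-- Directed paths along edges whose colors are read off from a list, head first. -/
def Path {V : Type} (E : ℕ → V → V → Prop) : List ℕ → V → V → Prop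
  | [], u, v => u = v
  | i :: L, u, v => ∃ w, E i u w ∧ Path E L w v

theorem Path.append {V : Type} {E : ℕ → V → V → Prop} {L L' : List ℕ} {u v w : V}
    (h : Path E L u v) (h' : Path E L' v w) : Path E (L ++ L') u w := by
  induction L generalizing u with
  | nil => cases h; exact h'
  | cons i L ih =>
    obtain ⟨x, hx, hp⟩ := h
    exact ⟨x, hx, ih hp⟩

/-- The local axioms of a crystal with colors in `C`, in terms of the edge relations and of the
lengths `t`, `h` of the monochromatic strings ending and beginning at a vertex. -/
structure LocalCrystal (C : Set ℕ) {V : Type} (E : ℕ → V → V → Prop) (t h : ℕ → V → ℤ) :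
    Prop where
  color : ∀ {i u v}, E i u v → i ∈ C
  func : ∀ {i u v v'}, E i u v → E i u v' → v = v'
  inj : ∀ {i u u' v}, E i u v → E i u' v → u = u'
  t_nonneg : ∀ i v, 0 ≤ t i v
  h_nonneg : ∀ i v, 0 ≤ h i v
  exists_in : ∀ {i v}, i ∈ C → 0 < t i v → ∃ u, E i u v
  exists_out : ∀ {i v}, i ∈ C → 0 < h i v → ∃ w, E i v w
  t_step : ∀ {i u v}, E i u v → t i v = t i u + 1
  h_step : ∀ {i u v}, E i u v → h i u = h i v + 1
  far : ∀ {i j u v}, E i u v → j ∈ C → Far i j → t j v = t j u ∧ h j v = h j u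
  neighb : ∀ {i j u v}, E i u v → j ∈ C → Neighb i j →
    (t j v = t j u ∧ h j v = h j u + 1) ∨ (t j v = t j u - 1 ∧ h j v = h j u)
  square : ∀ {i j u v v'}, Neighb i j → E i u v → E j u v' → t j v = t j u - 1 →
    t i v' = t i u ∧ ∃ w, E j v w ∧ E i v' w
  square_inv : ∀ {i j u u' v}, Neighb i j → E i u v → E j u' v → t j v = t j u →
    t i v = t i u' - 1 ∧ ∃ w, E j w u ∧ E i w u'
  verma : ∀ {i j u v v'}, Neighb i j → E i u v → E j u v' → t j v = t j u → t i v' = t i u →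
    ∃ x₁ x₂ y₁ y₂ z, (E j v x₁ ∧ E j x₁ x₂ ∧ E i x₂ z) ∧ (E i v' y₁ ∧ E i y₁ y₂ ∧ E j y₂ z)
  verma_inv : ∀ {i j u u' v}, Neighb i j → E i u v → E j u' v →
    t j v = t j u - 1 → t i v = t i u' - 1 →
    ∃ x₁ x₂ y₁ y₂ z, (E j x₁ u ∧ E j x₂ x₁ ∧ E i z x₂) ∧ (E i y₁ u' ∧ E i y₂ y₁ ∧ E j z y₂)
  far_square : ∀ {i j u v v'}, Far i j → E i u v → E j u v' → ∃ w, E j v w ∧ E i v' w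
  far_square_inv : ∀ {i j u u' v}, Far i j → E i u v → E j u' v → ∃ w, E j w u ∧ E i w u'

theorem eq_or_neighb_or_far (i j : ℕ) : j = i ∨ Neighb i j ∨ Far i j := by
  unfold Neighb Far; omega

theorem Neighb.symm {i j : ℕ} (h : Neighb i j) : Neighb j i := Or.symm h

section Sync

variable {C : Set ℕ} {V V' : Type} {E : ℕ → V → V → Prop} {E' : ℕ → V' → V' → Prop}
  {t h : ℕ → V → ℤ} {t' h' : ℕ → V' → ℤ}

/-- `b` and `v` are reached from `b₀` and `v₀` by the same string of length `d`. -/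
def Sync (E : ℕ → V → V → Prop) (E' : ℕ → V' → V' → Prop) (b₀ : V) (v₀ : V') :
    ℕ → V → V' → Prop
  | 0, b, v => b = b₀ ∧ v = v₀
  | d + 1, b, v => ∃ i b' v', Sync E E' b₀ v₀ d b' v' ∧ E i b' b ∧ E' i v' v

/-- The properties shared by synchronized vertices: equal incoming string lengths, outgoing
string lengths differing by `γ`, and synchronized predecessors. -/
structure SyncGood (C : Set ℕ) (E : ℕ → V → V → Prop) (E' : ℕ → V' → V' → Prop)
    (t h : ℕ → V → ℤ) (t' h' : ℕ → V' → ℤ) (γ : ℕ → ℤ) (b₀ : V) (v₀ : V')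
    (d : ℕ) (b : V) (v : V') : Prop where
  t_eq : ∀ i ∈ C, t' i v = t i b
  h_eq : ∀ i ∈ C, h' i v = h i b + γ i
  pred : ∀ {j w}, E j w b → ∃ e y, d = e + 1 ∧ Sync E E' b₀ v₀ e w y ∧ E' j y v

variable {γ : ℕ → ℤ} {b₀ : V} {v₀ : V'}

/-- In the situation of `verma_inv`, the two edges at the bottom vertex are both labeled one. -/
theorem LocalCrystal.verma_inv_labels (hB : LocalCrystal C E t h) {i j : ℕ} (hij : Neighb i j)
    {b b' w x₁ x₂ y₁ y₂ z : V} (hb : E i b' b) (hw : E j w b)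
    (hlj : t j b = t j b' - 1) (hli : t i b = t i w - 1)
    (hx₁ : E j x₁ b') (hx₂ : E j x₂ x₁) (hzx : E i z x₂)
    (hy₁ : E i y₁ w) (hy₂ : E i y₂ y₁) (hzy : E j z y₂) :
    t j x₂ = t j z ∧ t i y₂ = t i z := by
  have key : ∀ q, E j x₂ q → E i y₂ q → False := by
    intro q hq hq'
    obtain rfl := hB.func hq hx₂
    obtain rfl := hB.func hq' hy₂
    have h1 := hB.t_step hw
    have h2 := hB.t_step hx₁
    have h3 := hB.t_step hb
    have h4 := hB.t_step hy₁
    have := (hB.square hij hy₁ hx₁ (by omega)).1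
    omega
  constructor
  · rcases hB.neighb hzx (hB.color hw) hij with h1 | h1
    · exact h1.1
    · obtain ⟨-, q, hq, hq'⟩ := hB.square hij hzx hzy h1.1
      exact (key q hq hq').elim
  · rcases hB.neighb hzy (hB.color hb) hij.symm with h1 | h1
    · exact h1.1
    · obtain ⟨-, q, hq, hq'⟩ := hB.square hij.symm hzy hzx h1.1
      exact (key q hq' hq).elim

theorem exists_sync_succ (hK : LocalCrystal C E' t' h') (hB : LocalCrystal C E t h)
    (hγ : ∀ i ∈ C, 0 ≤ γ i) {d i : ℕ} {b b₁ : V} {v : V'}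
    (hg : SyncGood C E E' t h t' h' γ b₀ v₀ d b v) (hs : Sync E E' b₀ v₀ d b v)
    (he : E i b b₁) : ∃ v₁, E' i v v₁ ∧ Sync E E' b₀ v₀ (d + 1) b₁ v₁ := by
  have hi := hB.color he
  have h1 := hg.h_eq i hi
  have h2 := hB.h_step he
  have h3 := hB.h_nonneg i b₁
  have h4 := hγ i hi
  obtain ⟨v₁, hv₁⟩ := hK.exists_out (v := v) hi (by omega)
  exact ⟨v₁, hv₁, i, b, v, hs, he, hv₁⟩

theorem syncGood (hB : LocalCrystal C E t h) (hK : LocalCrystal C E' t' h')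
    (hγ : ∀ i ∈ C, 0 ≤ γ i) (hb₀ : ∀ i ∈ C, t i b₀ = 0) (hv₀ : ∀ i ∈ C, t' i v₀ = 0)
    (hh₀ : ∀ i ∈ C, h' i v₀ = h i b₀ + γ i) :
    ∀ d b v, Sync E E' b₀ v₀ d b v → SyncGood C E E' t h t' h' γ b₀ v₀ d b v := by
  intro d
  induction d using Nat.strong_induction_on with
  | _ d ih =>
  intro b v hs
  rcases d with _ | d
  · obtain ⟨rfl, rfl⟩ := hs
    refine ⟨fun i hi => by rw [hb₀ i hi, hv₀ i hi], hh₀, ?_⟩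
    intro j w hw
    have h1 := hB.t_step hw
    have h2 := hb₀ j (hB.color hw)
    have h3 := hB.t_nonneg j w
    omega
  obtain ⟨i, b', v', hs', hb, hv⟩ := hs
  have hi := hB.color hb
  have hg' := ih d (by omega) b' v' hs'
  have pred : ∀ {j w}, E j w b → ∃ y, Sync E E' b₀ v₀ d w y ∧ E' j y v := by
    intro j w hw
    have hj := hB.color hw
    rcases eq_or_neighb_or_far i j with rfl | hij | hij
    · obtain rfl := hB.inj hb hw
      exact ⟨v', hs', hv⟩
    · by_cases hc : t j b = t j b' ∨ t i b = t i w
      · obtain ⟨z, hzb, hzw⟩ : ∃ z, E j z b' ∧ E i z w := by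
          rcases hc with hc | hc
          · exact (hB.square_inv hij hb hw hc).2
          · obtain ⟨-, z, h1, h2⟩ := hB.square_inv hij.symm hw hb hc
            exact ⟨z, h2, h1⟩
        obtain ⟨e, y', rfl, hsz, hy'⟩ := hg'.pred hzb
        have hgz := ih e (by omega) z y' hsz
        obtain ⟨y, hy, hsy⟩ := exists_sync_succ hK hB hγ hgz hsz hzw
        have hgw := ih (e + 1) (by omega) w y hsy
        refine ⟨y, hsy, ?_⟩
        have e1 := hgz.t_eq i hi
        have e2 := hgz.t_eq j hj
        have e3 := hg'.t_eq i hi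
        have e4 := hgw.t_eq j hj
        have s1 := hB.t_step hb
        have s2 := hB.t_step hw
        have s3 := hB.t_step hzb
        have s4 := hB.t_step hzw
        obtain ⟨w', hw1, hw2⟩ : ∃ w', E' i v' w' ∧ E' j y w' := by
          rcases hc with hc | hc
          · have := (hB.square_inv hij hb hw hc).1
            exact (hK.square hij.symm hy' hy (by omega)).2
          · have := (hB.square_inv hij.symm hw hb hc).1
            obtain ⟨-, w', h1, h2⟩ := hK.square hij hy hy' (by omega)
            exact ⟨w', h2, h1⟩
        obtain rfl := hK.func hv hw1
        exact hw2
      · have hlj : t j b = t j b' - 1 := by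
          rcases hB.neighb hb hj hij with h1 | h1
          · exact (hc (Or.inl h1.1)).elim
          · exact h1.1
        have hli : t i b = t i w - 1 := by
          rcases hB.neighb hw hi hij.symm with h1 | h1
          · exact (hc (Or.inr h1.1)).elim
          · exact h1.1
        obtain ⟨x₁, x₂, y₁, y₂, z, ⟨hx₁, hx₂, hzx⟩, hy₁, hy₂, hzy⟩ :=
          hB.verma_inv hij hb hw hlj hli
        obtain ⟨hl1, hl2⟩ :=
          hB.verma_inv_labels hij hb hw hlj hli hx₁ hx₂ hzx hy₁ hy₂ hzy
        obtain ⟨_, X₁, rfl, hsX₁, hX₁⟩ := hg'.pred hx₁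
        obtain ⟨_, X₂, rfl, hsX₂, hX₂⟩ := (ih _ (by omega) _ _ hsX₁).pred hx₂
        have hgx₂ := ih _ (by omega) _ _ hsX₂
        obtain ⟨e, Z, rfl, hsZ, hZX⟩ := hgx₂.pred hzx
        have hgz := ih _ (by omega) _ _ hsZ
        obtain ⟨Y₂, hZY, hsY₂⟩ := exists_sync_succ hK hB hγ hgz hsZ hzy
        have hgy₂ := ih _ (by omega) _ _ hsY₂
        obtain ⟨Y₁, hY₂, hsY₁⟩ := exists_sync_succ hK hB hγ hgy₂ hsY₂ hy₂
        obtain ⟨Y, hY₁, hsY⟩ :=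
          exists_sync_succ hK hB hγ (ih _ (by omega) _ _ hsY₁) hsY₁ hy₁
        refine ⟨Y, hsY, ?_⟩
        have e1 := hgz.t_eq i hi
        have e2 := hgz.t_eq j hj
        have e3 := hgx₂.t_eq j hj
        have e4 := hgy₂.t_eq i hi
        obtain ⟨_, _, _, _, _, ⟨k1, k2, k3⟩, k4, k5, k6⟩ :=
          hK.verma hij hZX hZY (by omega) (by omega)
        obtain rfl := hK.func k1 hX₂
        obtain rfl := hK.func k2 hX₁
        obtain rfl := hK.func k3 hv
        obtain rfl := hK.func k4 hY₂
        obtain rfl := hK.func k5 hY₁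
        exact k6
    · obtain ⟨z, hzb, hzw⟩ := hB.far_square_inv hij hb hw
      obtain ⟨e, y', rfl, hsz, hy'⟩ := hg'.pred hzb
      obtain ⟨y, hy, hsy⟩ := exists_sync_succ hK hB hγ (ih e (by omega) z y' hsz) hsz hzw
      obtain ⟨w', hw1, hw2⟩ := hK.far_square hij hy hy'
      obtain rfl := hK.func hv hw2
      exact ⟨y, hsy, hw1⟩
  have t_eq : ∀ j ∈ C, t' j v = t j b := by
    intro j hj
    have e1 := hg'.t_eq j hj
    rcases eq_or_neighb_or_far i j with rfl | hij | hij
    · rw [hK.t_step hv, hB.t_step hb, e1]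
    · rcases (hB.t_nonneg j b).lt_or_eq with hpos | hzero
      · obtain ⟨w, hw⟩ := hB.exists_in hj hpos
        obtain ⟨y, hsy, hy⟩ := pred hw
        rw [hK.t_step hy, hB.t_step hw, (ih d (by omega) _ _ hsy).t_eq j hj]
      · by_contra hne
        have n1 := hK.t_nonneg j v
        have l1 := hB.neighb hb hj hij
        have l2 := hK.neighb hv hj hij
        obtain ⟨y, hy⟩ := hK.exists_in (v := v) hj (by omega)
        obtain ⟨hl, z, hz1, hz2⟩ := hK.square_inv hij hv hy (by omega)
        obtain ⟨w, hw⟩ := hB.exists_in (v := b') hj (by omega)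
        obtain ⟨e, y', rfl, hsw, hy'⟩ := hg'.pred hw
        obtain rfl := hK.inj hy' hz1
        have hgw := ih e (by omega) _ _ hsw
        have a1 := hgw.t_eq i hi
        have a2 := hg'.t_eq i hi
        have a3 := hK.t_step hv
        have a4 := hK.t_step hz2
        have a5 := hB.neighb hw hi hij.symm
        have a6 := hB.h_step hb
        have a7 := hB.h_nonneg i b
        obtain ⟨x, hx⟩ := hB.exists_out (v := w) hi (by omega)
        obtain ⟨-, z', hz3, hz4⟩ := hB.square hij.symm hw hx (by omega)
        obtain rfl := hB.func hz3 hb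
        have a8 := hB.t_step hz4
        have a9 := hB.t_nonneg j x
        omega
    · rw [(hK.far hv hj hij).1, (hB.far hb hj hij).1, e1]
  refine ⟨t_eq, ?_, ?_⟩
  · intro j hj
    have e1 := hg'.t_eq j hj
    have e2 := hg'.h_eq j hj
    have e3 := t_eq j hj
    rcases eq_or_neighb_or_far i j with rfl | hij | hij
    · have := hK.h_step hv
      have := hB.h_step hb
      omega
    · have l1 := hB.neighb hb hj hij
      have l2 := hK.neighb hv hj hij
      omega
    · rw [(hK.far hv hj hij).2, (hB.far hb hj hij).2, e2]
  · intro j w hw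
    obtain ⟨y, hsy, hy⟩ := pred hw
    exact ⟨d, y, rfl, hsy, hy⟩

theorem sync_unique (hK : LocalCrystal C E' t' h')
    (hgood : ∀ d b v, Sync E E' b₀ v₀ d b v → SyncGood C E E' t h t' h' γ b₀ v₀ d b v)
    {d : ℕ} {b : V} {v v' : V'} (h1 : Sync E E' b₀ v₀ d b v) (h2 : Sync E E' b₀ v₀ d b v') :
    v = v' := by
  induction d generalizing b v v' with
  | zero => exact h1.2.trans h2.2.symm
  | succ d ih =>
    obtain ⟨i, b', w, hs, hb, hw⟩ := h1
    obtain ⟨e, y, he, hsy, hy⟩ := (hgood _ _ _ h2).pred hb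
    obtain rfl : d = e := by omega
    obtain rfl := ih hs hsy
    exact hK.func hw hy

theorem exists_sync_path (hK : LocalCrystal C E' t' h') (hB : LocalCrystal C E t h)
    (hγ : ∀ i ∈ C, 0 ≤ γ i)
    (hgood : ∀ d b v, Sync E E' b₀ v₀ d b v → SyncGood C E E' t h t' h' γ b₀ v₀ d b v)
    {L : List ℕ} {d : ℕ} {b b₁ : V} {v : V'} (hs : Sync E E' b₀ v₀ d b v) (hp : Path E L b b₁) :
    ∃ v₁, Path E' L v v₁ ∧ Sync E E' b₀ v₀ (d + L.length) b₁ v₁ := by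
  induction L generalizing d b v with
  | nil => cases hp; exact ⟨v, rfl, hs⟩
  | cons i L ih =>
    obtain ⟨x, hx, hp⟩ := hp
    obtain ⟨y, hy, hsy⟩ := exists_sync_succ hK hB hγ (hgood _ _ _ hs) hs hx
    obtain ⟨v₁, hv₁, hs₁⟩ := ih hsy hp
    refine ⟨v₁, ⟨y, hy, hv₁⟩, ?_⟩
    rwa [List.length_cons, show d + (L.length + 1) = d + 1 + L.length by omega]

end Sync

section Confluence

variable {C : Set ℕ} {V : Type} {E : ℕ → V → V → Prop} {t h : ℕ → V → ℤ}

/-- If a vertex reaches a sink, then so does each of its successors, in one step less. -/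
theorem LocalCrystal.path_of_succ (hB : LocalCrystal C E t h) {z : V}
    (hz : ∀ i x, ¬ E i z x) : ∀ (N : ℕ) (L : List ℕ) (u : V), L.length = N → Path E L u z →
    ∀ i y, E i u y → ∃ L', L'.length + 1 = N ∧ Path E L' y z := by
  intro N
  induction N using Nat.strong_induction_on with
  | _ N ih =>
  intro L u hL hp j y hy
  rcases L with _ | ⟨i, L⟩
  · obtain rfl : u = z := hp
    exact (hz _ _ hy).elim
  obtain ⟨x, hx, hp⟩ := hp
  simp only [List.length_cons] at hL
  have descend : ∀ {M : ℕ} {i : ℕ} {a b : V}, M < N → E i a b →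
      (∃ L', L'.length = M ∧ Path E L' a z) → ∃ L', L'.length + 1 = M ∧ Path E L' b z := by
    rintro M i a b hM hab ⟨L', hL', hp'⟩
    exact ih M hM L' a hL' hp' i b hab
  have square_case : ∀ w, E j x w → E i y w → ∃ L', L'.length + 1 = N ∧ Path E L' y z := by
    intro w h1 h2
    obtain ⟨L', hL', hp'⟩ := descend (M := L.length) (by omega) h1 ⟨L, rfl, hp⟩
    exact ⟨i :: L', by simp only [List.length_cons]; omega, w, h2, hp'⟩
  have hi := hB.color hx
  have hj := hB.color hy
  rcases eq_or_neighb_or_far i j with rfl | hij | hij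
  · obtain rfl := hB.func hx hy
    exact ⟨L, hL, hp⟩
  · rcases hB.neighb hx hj hij with h1 | h1
    · rcases hB.neighb hy hi hij.symm with h2 | h2
      · obtain ⟨x₁, x₂, y₁, y₂, w, ⟨k1, k2, k3⟩, k4, k5, k6⟩ := hB.verma hij hx hy h1.1 h2.1
        obtain ⟨L₁, hL₁, hp₁⟩ := descend (M := L.length) (by omega) k1 ⟨L, rfl, hp⟩
        obtain ⟨L₂, hL₂, hp₂⟩ := descend (M := L₁.length) (by omega) k2 ⟨L₁, rfl, hp₁⟩
        obtain ⟨L₃, hL₃, hp₃⟩ := descend (M := L₂.length) (by omega) k3 ⟨L₂, rfl, hp₂⟩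
        exact ⟨i :: i :: j :: L₃, by simp only [List.length_cons]; omega,
          y₁, k4, y₂, k5, w, k6, hp₃⟩
      · obtain ⟨-, w, k1, k2⟩ := hB.square hij.symm hy hx h2.1
        exact square_case w k2 k1
    · obtain ⟨-, w, k1, k2⟩ := hB.square hij hx hy h1.1
      exact square_case w k1 k2
  · obtain ⟨w, k1, k2⟩ := hB.far_square hij hx hy
    exact square_case w k1 k2

theorem LocalCrystal.sink_unique (hB : LocalCrystal C E t h) {z z' : V}
    (hz : ∀ i x, ¬ E i z x) (hz' : ∀ i x, ¬ E i z' x) {L L' : List ℕ} {u : V}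
    (hp : Path E L u z) (hp' : Path E L' u z') : z = z' := by
  induction L' generalizing u L with
  | nil =>
    obtain rfl : u = z' := hp'
    rcases L with _ | ⟨i, L⟩
    · exact hp.symm
    · obtain ⟨x, hx, -⟩ := hp
      exact (hz' _ _ hx).elim
  | cons i L' ih =>
    obtain ⟨x, hx, hq⟩ := hp'
    obtain ⟨L₁, -, hp₁⟩ := hB.path_of_succ hz _ L u rfl hp i x hx
    exact ih hp₁ hq

/-- Strings joining the source to sinks in two crystals with equal parameters have the same end
in every crystal with a larger parameter. -/
theorem path_ends_eq {V' V'' : Type} {E' : ℕ → V' → V' → Prop} {E'' : ℕ → V'' → V'' → Prop}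
    {t' h' : ℕ → V' → ℤ} {t'' h'' : ℕ → V'' → ℤ} (hB : LocalCrystal C E t h)
    (hB' : LocalCrystal C E' t' h') (hK : LocalCrystal C E'' t'' h'') {b₀ b : V} {b₀' b' : V'}
    {v₀ : V''} (hb₀ : ∀ i ∈ C, t i b₀ = 0) (hb₀' : ∀ i ∈ C, t' i b₀' = 0)
    (hv₀ : ∀ i ∈ C, t'' i v₀ = 0) (hpar : ∀ i ∈ C, h i b₀ = h' i b₀')
    (hle : ∀ i ∈ C, h i b₀ ≤ h'' i v₀) {L L' : List ℕ} (hlen : L.length = L'.length)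
    (hp : Path E L b₀ b) (hp' : Path E' L' b₀' b') (hb : ∀ i ∈ C, h i b = 0)
    (hb' : ∀ i ∈ C, h' i b' = 0) : ∃ v, Path E'' L v₀ v ∧ Path E'' L' v₀ v := by
  have sink : ∀ b : V, (∀ i ∈ C, h i b = 0) → ∀ i x, ¬ E i b x := by
    intro b hb i x hx
    have h1 := hb i (hB.color hx)
    have h2 := hB.h_step hx
    have h3 := hB.h_nonneg i x
    omega
  have good := syncGood hB' hB (γ := fun _ => 0) (b₀ := b₀') (v₀ := b₀) (fun _ _ => le_rfl)
    hb₀' hb₀ (fun i hi => by rw [hpar i hi, add_zero])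
  obtain ⟨b₁, hq, hs⟩ := exists_sync_path hB hB' (fun _ _ => le_rfl) good
    (d := 0) ⟨rfl, rfl⟩ hp'
  have hb₁ : ∀ i ∈ C, h i b₁ = 0 := by
    intro i hi
    rw [(good _ _ _ hs).h_eq i hi, hb' i hi, add_zero]
  obtain rfl := hB.sink_unique (sink b hb) (sink b₁ hb₁) hp hq
  have hγ : ∀ i ∈ C, 0 ≤ h'' i v₀ - h i b₀ := fun i hi => sub_nonneg.2 (hle i hi)
  have good' := syncGood hB hK (γ := fun i => h'' i v₀ - h i b₀) hγ hb₀ hv₀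
    (fun i _ => by ring)
  obtain ⟨v, hv, hsv⟩ := exists_sync_path hK hB hγ good' (d := 0) ⟨rfl, rfl⟩ hp
  obtain ⟨v', hv', hsv'⟩ := exists_sync_path hK hB hγ good' (d := 0) ⟨rfl, rfl⟩ hq
  rw [← hlen] at hsv'
  obtain rfl := sync_unique hK good' hsv hsv'
  exact ⟨v, hv, hv'⟩

end Confluence

section OfCrystal

theorem le_sSup_iff_mem {S : Set ℕ} (hbdd : BddAbove S) (h0 : 0 ∈ S)
    (hdown : ∀ k, k + 1 ∈ S → k ∈ S) (k : ℕ) : k ≤ sSup S ↔ k ∈ S := by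
  constructor
  · intro hk
    have hmem : sSup S ∈ S := Nat.sSup_mem ⟨0, h0⟩ hbdd
    exact Nat.decreasingInduction' (P := fun k => k ∈ S) (fun l _ _ hl => hdown l hl) hk hmem
  · exact fun hk => le_csSup hbdd hk

theorem optIter_add {V : Type} (f : V → Option V) (a b : ℕ) (v : V) :
    optIter f (a + b) v = (optIter f a v).bind (optIter f b) := by
  induction a generalizing v with
  | zero => simp [optIter]
  | succ a ih =>
    rw [show a + 1 + b = (a + b) + 1 by omega]
    simp only [optIter, Option.bind_assoc]
    congr 1
    funext x
    exact ih x

theorem optIter_succ_eq_some {V : Type} {f : V → Option V} {k : ℕ} {u v : V} :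
    optIter f (k + 1) u = some v ↔ ∃ w, optIter f k u = some w ∧ f w = some v := by
  rw [optIter_add, Option.bind_eq_some_iff]
  simp [optIter]

theorem optIter_lt_card {V : Type} [Finite V] {f : V → Option V}
    (hf : ∀ v k, 0 < k → optIter f k v ≠ some v) {k : ℕ} {u v : V}
    (h : optIter f k u = some v) : k < Nat.card V := by
  by_contra hk
  have hsome : ∀ a : Fin (k + 1), ∃ x, optIter f a u = some x := by
    intro a
    have ha : (a : ℕ) + (k - a) = k := by omega
    rw [← ha, optIter_add, Option.bind_eq_some_iff] at h
    obtain ⟨x, hx, -⟩ := h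
    exact ⟨x, hx⟩
  choose g hg using hsome
  have hninj : ¬ Function.Injective g := by
    intro hinj
    have := Nat.card_le_card_of_injective g hinj
    rw [Nat.card_fin] at this
    omega
  have hlt : ∀ a b : Fin (k + 1), a < b → g a ≠ g b := by
    intro a b hab heq
    have h1 := hg b
    rw [show (b : ℕ) = a + (b - a) by omega, optIter_add, hg a] at h1
    refine hf (g a) (b - a) (by omega) ?_
    rw [heq] at h1 ⊢
    exact h1
  refine hninj fun a b hab => ?_
  rcases lt_trichotomy a b with h1 | h1 | h1
  · exact (hlt a b h1 hab).elim
  · exact h1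
  · exact (hlt b a h1 hab.symm).elim

variable {K : PreGraph} {C : Set ℕ}

theorem le_h_iff (hK : IsColored K C) (i k : ℕ) (v : K.V) :
    k ≤ K.h i v ↔ (optIter (K.F i) k v).isSome = true := by
  have := hK.1
  refine le_sSup_iff_mem (S := {k | (optIter (K.F i) k v).isSome = true}) ?_ ?_ ?_ k
  · refine ⟨Nat.card K.V, fun k hk => ?_⟩
    obtain ⟨w, hw⟩ := Option.isSome_iff_exists.1 hk
    exact (optIter_lt_card (hK.2.2.2 i) hw).le
  · simp [optIter]
  · intro k hk
    obtain ⟨w, hw⟩ := Option.isSome_iff_exists.1 hk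
    obtain ⟨x, hx, -⟩ := optIter_succ_eq_some.1 hw
    exact Option.isSome_iff_exists.2 ⟨x, hx⟩

theorem le_t_iff (hK : IsColored K C) (i k : ℕ) (v : K.V) :
    k ≤ K.t i v ↔ ∃ u, optIter (K.F i) k u = some v := by
  have := hK.1
  refine le_sSup_iff_mem (S := {k | ∃ u, optIter (K.F i) k u = some v}) ?_ ?_ ?_ k
  · refine ⟨Nat.card K.V, ?_⟩
    rintro k ⟨u, hu⟩
    exact (optIter_lt_card (hK.2.2.2 i) hu).le
  · exact ⟨v, rfl⟩
  · rintro k ⟨u, hu⟩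
    rw [optIter, Option.bind_eq_some_iff] at hu
    obtain ⟨x, -, hx⟩ := hu
    exact ⟨x, hx⟩

theorem h_step (hK : IsColored K C) {i : ℕ} {u v : K.V} (huv : K.F i u = some v) :
    K.h i u = K.h i v + 1 := by
  refine eq_of_forall_le_iff fun k => ?_
  rcases k with _ | k
  · simp
  · rw [Nat.add_le_add_iff_right, le_h_iff hK, le_h_iff hK, optIter, huv, Option.bind_some]

theorem t_step (hK : IsColored K C) {i : ℕ} {u v : K.V} (huv : K.F i u = some v) :
    K.t i v = K.t i u + 1 := by
  refine eq_of_forall_le_iff fun k => ?_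
  rcases k with _ | k
  · simp
  · rw [Nat.add_le_add_iff_right, le_t_iff hK, le_t_iff hK]
    constructor
    · rintro ⟨x, hx⟩
      obtain ⟨w, hw, hwv⟩ := optIter_succ_eq_some.1 hx
      obtain rfl := hK.2.2.1 i _ _ _ hwv huv
      exact ⟨x, hw⟩
    · rintro ⟨x, hx⟩
      exact ⟨x, optIter_succ_eq_some.2 ⟨u, hx, huv⟩⟩

theorem exists_out_of_h_pos (hK : IsColored K C) {i : ℕ} {v : K.V} (h : 0 < K.h i v) :
    ∃ w, K.F i v = some w := by
  obtain ⟨w, hw⟩ := Option.isSome_iff_exists.1 ((le_h_iff hK i 1 v).1 h)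
  obtain ⟨x, hx, hxw⟩ := optIter_succ_eq_some.1 hw
  cases hx
  exact ⟨w, hxw⟩

theorem exists_in_of_t_pos (hK : IsColored K C) {i : ℕ} {v : K.V} (h : 0 < K.t i v) :
    ∃ u, K.F i u = some v := by
  obtain ⟨u, hu⟩ := (le_t_iff hK i 1 v).1 h
  obtain ⟨x, hx, hxw⟩ := optIter_succ_eq_some.1 hu
  exact ⟨x, hxw⟩

theorem F_of_Finv {i : ℕ} {u v : K.V} (h : K.Finv i v = some u) : K.F i u = some v := by
  unfold PreGraph.Finv at h
  split_ifs at h with hex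
  cases h
  exact hex.choose_spec

theorem Finv_of_F (hK : IsColored K C) {i : ℕ} {u v : K.V} (h : K.F i u = some v) :
    K.Finv i v = some u := by
  have hex : ∃ u, K.F i u = some v := ⟨u, h⟩
  unfold PreGraph.Finv
  rw [dif_pos hex, hK.2.2.1 i _ _ _ hex.choose_spec h]

theorem bind₄_eq_some {V : Type} {f g k l : V → Option V} {v x : V}
    (h : (((f v).bind g).bind k).bind l = some x) :
    ∃ a b c, f v = some a ∧ g a = some b ∧ k b = some c ∧ l c = some x := by
  simp only [Option.bind_eq_some_iff] at h
  obtain ⟨c, ⟨b, ⟨a, h1, h2⟩, h3⟩, h4⟩ := h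
  exact ⟨a, b, c, h1, h2, h3, h4⟩

theorem not_neighb_of_far {i j : ℕ} (h : Far i j) : ¬ Neighb i j := by
  unfold Neighb Far at *; omega

theorem ne_of_neighb {i j : ℕ} (h : Neighb i j) : i ≠ j := by
  unfold Neighb at h; omega

theorem ne_of_far {i j : ℕ} (h : Far i j) : i ≠ j := by
  unfold Far at h; omega

theorem localCrystal_of_isCrystalOn (hK : IsCrystalOn K C) :
    LocalCrystal C (fun i u v => K.F i u = some v) (fun i v => (K.t i v : ℤ))
      (fun i v => (K.h i v : ℤ)) := by
  obtain ⟨hcol, -, hA2, hA34, hA5⟩ := hK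
  have color : ∀ {i u v}, K.F i u = some v → i ∈ C := by
    intro i u v h
    by_contra hi
    rw [hcol.2.1 i hi u] at h
    cases h
  have nb : ∀ {i j u v}, K.F i u = some v → j ∈ C → Neighb i j →
      ((K.t j v : ℤ) = K.t j u ∧ (K.h j v : ℤ) = K.h j u + 1) ∨
        ((K.t j v : ℤ) = K.t j u - 1 ∧ (K.h j v : ℤ) = K.h j u) := by
    intro i j u v h hj hij
    have h2 := (hA2 i (color h) j hj (ne_of_neighb hij)).1 u v h
    rw [if_pos hij] at h2
    omega
  refine
    { color := color
      func := fun h h' => Option.some_injective _ (h.symm.trans h')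
      inj := fun h h' => hcol.2.2.1 _ _ _ _ h h'
      t_nonneg := fun _ _ => Int.natCast_nonneg _
      h_nonneg := fun _ _ => Int.natCast_nonneg _
      exists_in := fun _ h => exists_in_of_t_pos hcol (by exact_mod_cast h)
      exists_out := fun _ h => exists_out_of_h_pos hcol (by exact_mod_cast h)
      t_step := fun h => by exact_mod_cast t_step hcol h
      h_step := fun h => by exact_mod_cast h_step hcol h
      far := ?_
      neighb := nb
      square := ?_
      square_inv := ?_
      verma := ?_
      verma_inv := ?_
      far_square := ?_
      far_square_inv := ?_ }
  · intro i j u v h hj hij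
    have h2 := (hA2 i (color h) j hj (ne_of_far hij)).1 u v h
    rw [if_neg (not_neighb_of_far hij)] at h2
    omega
  · intro i j u v v' hij h h' hl
    have n1 := nb h (color h') hij
    have n2 := nb h' (color h) hij.symm
    obtain ⟨h1, h2⟩ := (hA34 i (color h) j (color h') hij).1.1 u v v' h h' (by omega)
    exact ⟨by omega, h2⟩
  · intro i j u u' v hij h h' hl
    have n1 := nb h (color h') hij
    have n2 := nb h' (color h) hij.symm
    obtain ⟨h1, h2⟩ := (hA34 i (color h) j (color h') hij).1.2 u u' v h h' (by omega)
    exact ⟨by omega, h2⟩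
  · intro i j u v v' hij h h' hl hl'
    have n1 := nb h (color h') hij
    have n2 := nb h' (color h) hij.symm
    obtain ⟨w, h1, h2⟩ := (hA34 i (color h) j (color h') hij).2.1 u v v' h h'
      (by omega) (by omega)
    obtain ⟨a, b, c, k1, k2, k3, k4⟩ := bind₄_eq_some h1
    obtain ⟨a', b', c', k1', k2', k3', k4'⟩ := bind₄_eq_some h2
    obtain rfl := Option.some_injective _ (k1.symm.trans h)
    obtain rfl := Option.some_injective _ (k1'.symm.trans h')
    exact ⟨b, c, b', c', w, ⟨k2, k3, k4⟩, k2', k3', k4'⟩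
  · intro i j u u' v hij h h' hl hl'
    have n1 := nb h (color h') hij
    have n2 := nb h' (color h) hij.symm
    obtain ⟨w, h1, h2⟩ := (hA34 i (color h) j (color h') hij).2.2 u u' v h h'
      (by omega) (by omega)
    obtain ⟨a, b, c, k1, k2, k3, k4⟩ := bind₄_eq_some h1
    obtain ⟨a', b', c', k1', k2', k3', k4'⟩ := bind₄_eq_some h2
    obtain rfl := hcol.2.2.1 _ _ _ _ (F_of_Finv k1) h
    obtain rfl := hcol.2.2.1 _ _ _ _ (F_of_Finv k1') h'
    exact ⟨b, c, b', c', w, ⟨F_of_Finv k2, F_of_Finv k3, F_of_Finv k4⟩,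
      F_of_Finv k2', F_of_Finv k3', F_of_Finv k4'⟩
  · intro i j u v v' hij h h'
    obtain ⟨w, h1, h2⟩ := hA5 i (color h) j (color h') hij (K.F i) (by simp) (K.F j) (by simp) u
      (by simp [h]) (by simp [h'])
    rw [h, Option.bind_some] at h1
    rw [h', Option.bind_some] at h2
    exact ⟨w, h1, h2⟩
  · intro i j u u' v hij h h'
    obtain ⟨w, h1, h2⟩ := hA5 i (color h) j (color h') hij (K.Finv i) (by simp) (K.Finv j)
      (by simp) v (by simp [Finv_of_F hcol h]) (by simp [Finv_of_F hcol h'])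
    rw [Finv_of_F hcol h, Option.bind_some] at h1
    rw [Finv_of_F hcol h', Option.bind_some] at h2
    exact ⟨w, F_of_Finv h1, F_of_Finv h2⟩

theorem path_iff_applyStr {L : List ℕ} {u v : K.V} :
    Path (fun i u v => K.F i u = some v) L u v ↔ applyStr K L u = some v := by
  induction L generalizing u with
  | nil => simp [Path, applyStr]
  | cons i L ih => simp only [Path, applyStr, Option.bind_eq_some_iff, ih]

end OfCrystal

section Words

/-- The pairing of the weight of the column `A` with the simple coroot of color `i`. -/
noncomputable def pairing (i : ℕ) (A : Set ℕ) : ℤ :=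
  (if i ∈ A then 1 else 0) - (if i + 1 ∈ A then 1 else 0)

/-- Replace `i` by `i + 1` in a column. -/
def raise (i : ℕ) (A : Set ℕ) : Set ℕ := insert (i + 1) (A \ {i})

/-- Cartan matrix entries of type A. -/
def cartan (i j : ℕ) : ℤ := if j = i then 2 else if Neighb i j then -1 else 0

/-- The weight of the first `x` columns of a word, paired with the coroot of color `i`. -/
noncomputable def height (i : ℕ) (w : ℕ → Set ℕ) (x : ℕ) : ℤ :=
  ∑ q ∈ Finset.range x, pairing i (w q)

/-- Replace `i` by `i + 1` in the column at position `p`. -/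
noncomputable def raiseAt (i p : ℕ) (w : ℕ → Set ℕ) : ℕ → Set ℕ :=
  Function.update w p (raise i (w p))

/-- `p` is the last point of `[0, m]` at which `f` is minimal. -/
def LastMin (m : ℕ) (f : ℕ → ℤ) (p : ℕ) : Prop :=
  p ≤ m ∧ ∀ x ≤ m, f p ≤ f x ∧ (p < x → f p < f x)

/-- The `i`-edges of the crystal of words of `m` columns. -/
def WordEdge (m i : ℕ) (w w' : ℕ → Set ℕ) : Prop :=
  ∃ p < m, LastMin m (height i w) p ∧ w' = raiseAt i p w

/-- The minimum of `f` on `[0, m]`. -/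
noncomputable def minOn (m : ℕ) (f : ℕ → ℤ) : ℤ :=
  (Finset.range (m + 1)).inf' ⟨0, by simp⟩ f

theorem minOn_le {m : ℕ} (f : ℕ → ℤ) {x : ℕ} (hx : x ≤ m) : minOn m f ≤ f x :=
  Finset.inf'_le _ (Finset.mem_range.2 (by omega))

theorem exists_eq_minOn (m : ℕ) (f : ℕ → ℤ) : ∃ x ≤ m, f x = minOn m f := by
  obtain ⟨x, hx, h⟩ := Finset.exists_mem_eq_inf' (s := Finset.range (m + 1)) ⟨0, by simp⟩ f
  exact ⟨x, by simpa [Nat.lt_succ_iff] using hx, h.symm⟩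

theorem minOn_eq {m : ℕ} {f : ℕ → ℤ} {p : ℕ} (hp : p ≤ m) (h : ∀ x ≤ m, f p ≤ f x) :
    minOn m f = f p := by
  obtain ⟨x, hx, hxe⟩ := exists_eq_minOn m f
  have := minOn_le f hp
  have := h x hx
  omega

theorem exists_lastMin (m : ℕ) (f : ℕ → ℤ) : ∃ p, LastMin m f p := by
  induction m with
  | zero =>
    refine ⟨0, le_rfl, fun x hx => ?_⟩
    obtain rfl : x = 0 := by omega
    exact ⟨le_rfl, by omega⟩
  | succ m ih =>
    obtain ⟨p, hp, h⟩ := ih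
    by_cases hc : f p < f (m + 1)
    · refine ⟨p, by omega, fun x hx => ?_⟩
      rcases Nat.lt_or_ge m x with hx' | hx'
      · obtain rfl : x = m + 1 := by omega
        omega
      · exact h x hx'
    · refine ⟨m + 1, le_rfl, fun x hx => ⟨?_, by omega⟩⟩
      rcases Nat.lt_or_ge m x with hx' | hx'
      · obtain rfl : x = m + 1 := by omega
        omega
      · have := (h x hx').1
        omega

theorem LastMin.unique {m : ℕ} {f : ℕ → ℤ} {p q : ℕ} (hp : LastMin m f p) (hq : LastMin m f q) :
    p = q := by
  have h1 := hp.2 q hq.1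
  have h2 := hq.2 p hp.1
  omega

theorem LastMin.minOn_eq {m : ℕ} {f : ℕ → ℤ} {p : ℕ} (hp : LastMin m f p) : minOn m f = f p :=
  PrincipalLattice.minOn_eq hp.1 fun x hx => (hp.2 x hx).1

theorem pairing_raise {i : ℕ} {A : Set ℕ} (h1 : i ∈ A) (h2 : i + 1 ∉ A) (j : ℕ) :
    pairing j (raise i A) = pairing j A - cartan i j := by
  unfold pairing raise cartan Neighb
  by_cases hji : j = i
  · subst hji
    simp [h1, h2]
  by_cases hji' : j = i + 1
  · subst hji'
    simp [h2, show ¬ i + 1 + 1 = i by omega]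
    ring
  by_cases hji'' : j + 1 = i
  · subst hji''
    simp [h1, show ¬ j = j + 1 + 1 by omega]
  simp [hji, hji', hji'', show ¬ i + 1 = j by omega]

theorem height_zero (i : ℕ) (w : ℕ → Set ℕ) : height i w 0 = 0 := by simp [height]

theorem height_succ (i : ℕ) (w : ℕ → Set ℕ) (x : ℕ) :
    height i w (x + 1) = height i w x + pairing i (w x) := Finset.sum_range_succ _ _

theorem height_raiseAt {i p : ℕ} {w : ℕ → Set ℕ} (h1 : i ∈ w p) (h2 : i + 1 ∉ w p) (j x : ℕ) :
    height j (raiseAt i p w) x = height j w x - if p < x then cartan i j else 0 := by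
  induction x with
  | zero => simp [height_zero]
  | succ x ih =>
    rw [height_succ, height_succ, ih]
    by_cases hx : x = p
    · subst hx
      simp [raiseAt, pairing_raise h1 h2]
      ring
    · have h3 : p < x + 1 ↔ p < x := by omega
      simp only [raiseAt, Function.update_of_ne hx, h3]
      ring

theorem LastMin.mem {m i p : ℕ} {w : ℕ → Set ℕ} (hp : p < m) (h : LastMin m (height i w) p) :
    i ∈ w p ∧ i + 1 ∉ w p := by
  have h1 := (h.2 (p + 1) (by omega)).2 (by omega)
  rw [height_succ, pairing] at h1
  split_ifs at h1 <;> simp_all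

theorem LastMin.height_succ {m i p : ℕ} {w : ℕ → Set ℕ} (hp : p < m)
    (h : LastMin m (height i w) p) : height i w (p + 1) = height i w p + 1 := by
  rw [PrincipalLattice.height_succ, pairing, if_pos (h.mem hp).1, if_neg (h.mem hp).2, sub_zero]

theorem raiseAt_comm {p q : ℕ} (hpq : p ≠ q) (i j : ℕ) (w : ℕ → Set ℕ) :
    raiseAt i p (raiseAt j q w) = raiseAt j q (raiseAt i p w) := by
  simp only [raiseAt, Function.update_of_ne hpq, Function.update_of_ne hpq.symm]
  exact Function.update_comm hpq.symm _ _ _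

theorem cartan_self (i : ℕ) : cartan i i = 2 := by simp [cartan]

theorem cartan_neighb {i j : ℕ} (h : Neighb i j) : cartan i j = -1 := by
  rw [cartan, if_neg (ne_of_neighb h).symm, if_pos h]

theorem cartan_far {i j : ℕ} (h : Far i j) : cartan i j = 0 := by
  rw [cartan, if_neg (ne_of_far h).symm, if_neg (not_neighb_of_far h)]

theorem height_raise_self {m i p : ℕ} {w : ℕ → Set ℕ} (hp : p < m)
    (h : LastMin m (height i w) p) (x : ℕ) :
    height i (raiseAt i p w) x = height i w x - if p < x then 2 else 0 := by
  rw [height_raiseAt (h.mem hp).1 (h.mem hp).2, cartan_self]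

theorem height_raise_neighb {m i j p : ℕ} {w : ℕ → Set ℕ} (hp : p < m)
    (h : LastMin m (height i w) p) (hij : Neighb i j) (x : ℕ) :
    height j (raiseAt i p w) x = height j w x + if p < x then 1 else 0 := by
  rw [height_raiseAt (h.mem hp).1 (h.mem hp).2, cartan_neighb hij]
  split_ifs <;> ring

theorem height_raise_far {m i j p : ℕ} {w : ℕ → Set ℕ} (hp : p < m)
    (h : LastMin m (height i w) p) (hij : Far i j) (x : ℕ) :
    height j (raiseAt i p w) x = height j w x := by
  rw [height_raiseAt (h.mem hp).1 (h.mem hp).2, cartan_far hij]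
  simp

/-- The length of the `i`-string ending at a word. -/
noncomputable def wordT (m i : ℕ) (w : ℕ → Set ℕ) : ℤ := -minOn m (height i w)

/-- The length of the `i`-string beginning at a word. -/
noncomputable def wordH (m i : ℕ) (w : ℕ → Set ℕ) : ℤ := height i w m - minOn m (height i w)

theorem minOn_raise_self {m i p : ℕ} {w : ℕ → Set ℕ} (hp : p < m)
    (h : LastMin m (height i w) p) :
    minOn m (height i (raiseAt i p w)) = minOn m (height i w) - 1 := by
  rw [h.minOn_eq, minOn_eq (p := p + 1) (by omega)]
  · rw [height_raise_self hp h, h.height_succ hp]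
    simp
    ring
  · intro x hx
    rw [height_raise_self hp h, height_raise_self hp h, h.height_succ hp]
    have := h.2 x hx
    split_ifs <;> omega

/-- Raising `i` shifts the minimum for a neighboring color `j` unless it is attained up to the
position of the change. -/
theorem minOn_raise_neighb {m i j p : ℕ} {w : ℕ → Set ℕ} (hp : p < m)
    (h : LastMin m (height i w) p) (hij : Neighb i j) :
    ((∃ x ≤ p, height j w x = minOn m (height j w)) ∧
      minOn m (height j (raiseAt i p w)) = minOn m (height j w)) ∨
    ((∀ x ≤ p, minOn m (height j w) < height j w x) ∧
      minOn m (height j (raiseAt i p w)) = minOn m (height j w) + 1) := by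
  by_cases hc : ∃ x ≤ p, height j w x = minOn m (height j w)
  · refine Or.inl ⟨hc, ?_⟩
    obtain ⟨x, hx, hxe⟩ := hc
    rw [minOn_eq (p := x) (by omega), height_raise_neighb hp h hij, if_neg (by omega), hxe,
      add_zero]
    intro y hy
    rw [height_raise_neighb hp h hij, height_raise_neighb hp h hij, if_neg (by omega), hxe]
    have := minOn_le (height j w) hy
    split_ifs <;> omega
  · have hlt : ∀ x ≤ p, minOn m (height j w) < height j w x := fun x hx =>
      lt_of_le_of_ne (minOn_le _ (by omega)) fun he => hc ⟨x, hx, he.symm⟩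
    refine Or.inr ⟨hlt, ?_⟩
    obtain ⟨x, hx, hxe⟩ := exists_eq_minOn m (height j w)
    have hpx : p < x := by
      by_contra hpx
      have := hlt x (by omega)
      omega
    rw [minOn_eq (p := x) hx, height_raise_neighb hp h hij, if_pos hpx, hxe]
    intro y hy
    rw [height_raise_neighb hp h hij, height_raise_neighb hp h hij, if_pos hpx, hxe]
    have := minOn_le (height j w) hy
    have := hlt y
    split_ifs <;> omega

theorem wordEdge_t_step {m i : ℕ} {u v : ℕ → Set ℕ} (h : WordEdge m i u v) :
    wordT m i v = wordT m i u + 1 := by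
  obtain ⟨p, hp, hl, rfl⟩ := h
  rw [wordT, wordT, minOn_raise_self hp hl]
  ring

theorem wordEdge_h_step {m i : ℕ} {u v : ℕ → Set ℕ} (h : WordEdge m i u v) :
    wordH m i u = wordH m i v + 1 := by
  obtain ⟨p, hp, hl, rfl⟩ := h
  rw [wordH, wordH, minOn_raise_self hp hl, height_raise_self hp hl, if_pos hp]
  ring

theorem wordEdge_far {m i j : ℕ} {u v : ℕ → Set ℕ} (h : WordEdge m i u v) (hij : Far i j) :
    wordT m j v = wordT m j u ∧ wordH m j v = wordH m j u := by
  obtain ⟨p, hp, hl, rfl⟩ := h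
  have : height j (raiseAt i p u) = height j u := funext (height_raise_far hp hl hij)
  simp only [wordT, wordH, this, and_self]

theorem wordEdge_neighb {m i j : ℕ} {u v : ℕ → Set ℕ} (h : WordEdge m i u v)
    (hij : Neighb i j) :
    (wordT m j v = wordT m j u ∧ wordH m j v = wordH m j u + 1) ∨
      (wordT m j v = wordT m j u - 1 ∧ wordH m j v = wordH m j u) := by
  obtain ⟨p, hp, hl, rfl⟩ := h
  have h1 := height_raise_neighb hp hl hij m
  rw [if_pos hp] at h1
  rw [wordT, wordT, wordH, wordH, h1]
  rcases minOn_raise_neighb hp hl hij with h2 | h2 <;> rw [h2.2]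
  · left; constructor <;> ring
  · right; constructor <;> ring

theorem wordEdge_square {m i j : ℕ} {u v v' : ℕ → Set ℕ} (hij : Neighb i j)
    (h : WordEdge m i u v) (h' : WordEdge m j u v') (hlab : wordT m j v = wordT m j u - 1) :
    wordT m i v' = wordT m i u ∧ ∃ w, WordEdge m j v w ∧ WordEdge m i v' w := by
  obtain ⟨p, hp, hl, rfl⟩ := h
  obtain ⟨q, hq, hl', rfl⟩ := h'
  rw [wordT, wordT] at hlab
  have hlt : ∀ x ≤ p, minOn m (height j u) < height j u x := by
    rcases minOn_raise_neighb hp hl hij with h2 | h2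
    · omega
    · exact h2.1
  rw [hl'.minOn_eq] at hlt
  have hpq : p < q := by
    by_contra hpq
    have := hlt q (by omega)
    omega
  constructor
  · rcases minOn_raise_neighb hq hl' hij.symm with h2 | h2
    · rw [wordT, wordT, h2.2]
    · have := h2.1 p hpq.le
      rw [hl.minOn_eq] at this
      omega
  · refine ⟨raiseAt j q (raiseAt i p u), ⟨q, hq, ⟨hq.le, fun x hx => ?_⟩, rfl⟩,
      ⟨p, hp, ⟨hp.le, fun x hx => ?_⟩, raiseAt_comm (by omega) _ _ _⟩⟩
    · rw [height_raise_neighb hp hl hij, height_raise_neighb hp hl hij]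
      have := hl'.2 x hx
      have := hlt x
      split_ifs <;> omega
    · rw [height_raise_neighb hq hl' hij.symm, height_raise_neighb hq hl' hij.symm]
      have := hl.2 x hx
      split_ifs <;> omega

theorem wordEdge_far_square {m i j : ℕ} {u v v' : ℕ → Set ℕ} (hij : Far i j)
    (h : WordEdge m i u v) (h' : WordEdge m j u v') :
    ∃ w, WordEdge m j v w ∧ WordEdge m i v' w := by
  obtain ⟨p, hp, hl, rfl⟩ := h
  obtain ⟨q, hq, hl', rfl⟩ := h'
  have e1 : height j (raiseAt i p u) = height j u := funext (height_raise_far hp hl hij)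
  have e2 : height i (raiseAt j q u) = height i u := funext (height_raise_far hq hl' (Or.symm hij))
  refine ⟨raiseAt j q (raiseAt i p u), ⟨q, hq, by rwa [e1], rfl⟩, ⟨p, hp, by rwa [e2], ?_⟩⟩
  by_cases hpq : p = q
  · subst hpq
    have m1 := hl.mem hp
    have m2 := hl'.mem hq
    have : raise j (raise i (u p)) = raise i (raise j (u p)) := by
      ext x
      unfold Far at hij
      simp only [raise, Set.mem_insert_iff, Set.mem_sdiff, Set.mem_singleton_iff]
      grind
    simp [raiseAt, this]
  · exact raiseAt_comm (Ne.symm hpq) _ _ _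

theorem verma_of_lt {m i j p q : ℕ} {w : ℕ → Set ℕ} (hij : Neighb i j) (hpq : p < q)
    (hq : q < m) (hi : LastMin m (height i w) p) (hj : LastMin m (height j w) q)
    (hex : ∃ x ≤ p, height j w x = height j w q) :
    ∃ x₁ x₂ y₁ y₂ z,
      (WordEdge m j (raiseAt i p w) x₁ ∧ WordEdge m j x₁ x₂ ∧ WordEdge m i x₂ z) ∧
      (WordEdge m i (raiseAt j q w) y₁ ∧ WordEdge m i y₁ y₂ ∧ WordEdge m j y₂ z) := by
  have hp : p < m := by omega
  obtain ⟨q', hq'p, hq'⟩ := exists_lastMin p (height j w)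
  have hq'e : height j w q' = height j w q := by
    obtain ⟨x, hx, hxe⟩ := hex
    have := hq' x hx
    have := hj.2 q' (by omega)
    omega
  obtain ⟨r, hr, hpr, hrq, hrlast⟩ : ∃ r, height i w r = height i w p + 1 ∧ p < r ∧ r ≤ q ∧
      ∀ x, r < x → x ≤ q → height i w p + 1 < height i w x := by
    obtain ⟨r, hr, hmin⟩ := exists_lastMin q (fun x => if p < x then height i w x else
      height i w p + 2)
    have h1 := (hmin (p + 1) (by omega)).1
    simp only [show p < p + 1 by omega, if_true, hi.height_succ hp] at h1
    have hpr : p < r := by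
      by_contra hpr
      rw [if_neg hpr] at h1
      omega
    rw [if_pos hpr] at h1
    have h2 := (hi.2 r (by omega)).2 hpr
    refine ⟨r, by omega, hpr, hr, fun x hx hxq => ?_⟩
    have h3 := (hmin x hxq).2 hx
    simp only [if_pos hpr, if_pos (hpr.trans hx)] at h3
    omega
  have hji := hij.symm
  have bounds : ∀ x ≤ m, (height i w p ≤ height i w x ∧ (p < x → height i w p < height i w x)) ∧
      (height j w q ≤ height j w x ∧ (q < x → height j w q < height j w x)) ∧
      (q' < x → x ≤ p → height j w q < height j w x) ∧
      (r < x → x ≤ q → height i w p + 1 < height i w x) := fun x hx =>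
    ⟨hi.2 x hx, hj.2 x hx, fun h1 h2 => by have := (hq' x h2).2 h1; omega, hrlast x⟩
  -- the route through `raiseAt i p w`
  have a1 := height_raise_neighb hp hi hij
  have b1 := height_raise_self hp hi
  have l1 : LastMin m (height j (raiseAt i p w)) q' := by
    refine ⟨by omega, fun x hx => ?_⟩
    have := bounds x hx
    rw [a1, a1]
    split_ifs <;> omega
  have a2 := height_raise_self (by omega) l1
  have b2 := height_raise_neighb (by omega) l1 hji
  have l2 : LastMin m (height j (raiseAt j q' (raiseAt i p w))) q := by
    refine ⟨by omega, fun x hx => ?_⟩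
    have := bounds x hx
    rw [a2, a2, a1, a1]
    split_ifs <;> omega
  have b3 := height_raise_neighb hq l2 hji
  have l3 : LastMin m (height i (raiseAt j q (raiseAt j q' (raiseAt i p w)))) r := by
    refine ⟨by omega, fun x hx => ?_⟩
    have := bounds x hx
    rw [b3, b3, b2, b2, b1, b1]
    split_ifs <;> omega
  -- the route through `raiseAt j q w`
  have c1 := height_raise_neighb hq hj hji
  have d1 := height_raise_self hq hj
  have k1 : LastMin m (height i (raiseAt j q w)) p := by
    refine ⟨by omega, fun x hx => ?_⟩
    have := bounds x hx
    rw [c1, c1]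
    split_ifs <;> omega
  have c2 := height_raise_self hp k1
  have d2 := height_raise_neighb hp k1 hij
  have k2 : LastMin m (height i (raiseAt i p (raiseAt j q w))) r := by
    refine ⟨by omega, fun x hx => ?_⟩
    have := bounds x hx
    rw [c2, c2, c1, c1]
    split_ifs <;> omega
  have d3 := height_raise_neighb (by omega) k2 hij
  have k3 : LastMin m (height j (raiseAt i r (raiseAt i p (raiseAt j q w)))) q' := by
    refine ⟨by omega, fun x hx => ?_⟩
    have := bounds x hx
    rw [d3, d3, d2, d2, d1, d1]
    split_ifs <;> omega
  refine ⟨_, _, _, _, _, ⟨⟨q', by omega, l1, rfl⟩, ⟨q, hq, l2, rfl⟩, ⟨r, by omega, l3, rfl⟩⟩,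
    ⟨p, hp, k1, rfl⟩, ⟨r, by omega, k2, rfl⟩, ⟨q', by omega, k3, ?_⟩⟩
  rw [raiseAt_comm (show q' ≠ r by omega) j i, raiseAt_comm (show p ≠ q by omega) i j w,
    raiseAt_comm (show q' ≠ q by omega)]

theorem wordEdge_verma {m i j : ℕ} {u v v' : ℕ → Set ℕ} (hij : Neighb i j)
    (h : WordEdge m i u v) (h' : WordEdge m j u v') (hlab : wordT m j v = wordT m j u)
    (hlab' : wordT m i v' = wordT m i u) :
    ∃ x₁ x₂ y₁ y₂ z, (WordEdge m j v x₁ ∧ WordEdge m j x₁ x₂ ∧ WordEdge m i x₂ z) ∧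
      (WordEdge m i v' y₁ ∧ WordEdge m i y₁ y₂ ∧ WordEdge m j y₂ z) := by
  obtain ⟨p, hp, hl, rfl⟩ := h
  obtain ⟨q, hq, hl', rfl⟩ := h'
  rw [wordT, wordT] at hlab hlab'
  rcases lt_trichotomy p q with hpq | hpq | hpq
  · refine verma_of_lt hij hpq hq hl hl' ?_
    rw [← hl'.minOn_eq]
    rcases minOn_raise_neighb hp hl hij with h2 | h2
    · exact h2.1
    · omega
  · subst hpq
    have m1 := hl.mem hp
    have m2 := hl'.mem hq
    rcases hij with rfl | rfl
    · exact (m1.2 m2.1).elim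
    · exact (m2.2 m1.1).elim
  · obtain ⟨x₁, x₂, y₁, y₂, z, k1, k2⟩ := verma_of_lt hij.symm hpq hp hl' hl (by
      rw [← hl.minOn_eq]
      rcases minOn_raise_neighb hq hl' hij.symm with h2 | h2
      · exact h2.1
      · omega)
    exact ⟨y₁, y₂, x₁, x₂, z, k2, k1⟩


theorem wordT_nonneg (m i : ℕ) (w : ℕ → Set ℕ) : 0 ≤ wordT m i w := by
  have := minOn_le (height i w) (Nat.zero_le m)
  rw [height_zero] at this
  rw [wordT]
  omega

theorem wordH_nonneg (m i : ℕ) (w : ℕ → Set ℕ) : 0 ≤ wordH m i w := by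
  have := minOn_le (height i w) (le_refl m)
  rw [wordH]
  omega

theorem exists_wordEdge_out {m i : ℕ} {w : ℕ → Set ℕ} (h : 0 < wordH m i w) :
    ∃ w', WordEdge m i w w' := by
  obtain ⟨p, hp⟩ := exists_lastMin m (height i w)
  refine ⟨_, p, lt_of_le_of_ne hp.1 ?_, hp, rfl⟩
  rintro rfl
  rw [wordH, hp.minOn_eq] at h
  omega

theorem wordEdge_func {m i : ℕ} {u v v' : ℕ → Set ℕ} (h : WordEdge m i u v)
    (h' : WordEdge m i u v') : v = v' := by
  obtain ⟨p, -, hl, rfl⟩ := h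
  obtain ⟨q, -, hl', rfl⟩ := h'
  rw [hl.unique hl']

/-- The word with the order of the columns reversed and every column complemented. -/
noncomputable def dual (m : ℕ) (w : ℕ → Set ℕ) : ℕ → Set ℕ :=
  fun q => if q < m then (w (m - 1 - q))ᶜ else w q

theorem dual_dual (m : ℕ) (w : ℕ → Set ℕ) : dual m (dual m w) = w := by
  funext q
  by_cases hq : q < m
  · simp [dual, hq, show m - 1 - q < m by omega, show m - 1 - (m - 1 - q) = q by omega]
  · simp [dual, hq]

theorem pairing_compl (i : ℕ) (A : Set ℕ) : pairing i Aᶜ = -pairing i A := by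
  simp only [pairing, Set.mem_compl_iff]
  split_ifs <;> simp_all

theorem height_dual {m : ℕ} (i : ℕ) (w : ℕ → Set ℕ) {x : ℕ} (hx : x ≤ m) :
    height i (dual m w) x = height i w (m - x) - height i w m := by
  induction x with
  | zero => simp [height_zero]
  | succ x ih =>
    have h1 := height_succ i w (m - 1 - x)
    rw [show m - 1 - x + 1 = m - x by omega] at h1
    rw [height_succ, ih (by omega), dual, if_pos (by omega), pairing_compl, h1,
      show m - (x + 1) = m - 1 - x by omega]
    ring

theorem minOn_height_dual (m i : ℕ) (w : ℕ → Set ℕ) :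
    minOn m (height i (dual m w)) = minOn m (height i w) - height i w m := by
  obtain ⟨x, hx, hxe⟩ := exists_eq_minOn m (height i w)
  rw [minOn_eq (p := m - x) (by omega), height_dual _ _ (by omega),
    show m - (m - x) = x by omega, hxe]
  intro y hy
  rw [height_dual _ _ (by omega), height_dual _ _ hy, show m - (m - x) = x by omega, hxe]
  have := minOn_le (height i w) (show m - y ≤ m by omega)
  omega

theorem wordT_dual (m i : ℕ) (w : ℕ → Set ℕ) : wordT m i (dual m w) = wordH m i w := by
  rw [wordT, wordH, minOn_height_dual]
  ring

theorem wordH_dual (m i : ℕ) (w : ℕ → Set ℕ) : wordH m i (dual m w) = wordT m i w := by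
  rw [wordT, wordH, minOn_height_dual, height_dual _ _ le_rfl, Nat.sub_self, height_zero]
  ring

theorem raise_compl_raise {i : ℕ} {A : Set ℕ} (h1 : i ∈ A) (h2 : i + 1 ∉ A) :
    raise i (raise i A)ᶜ = Aᶜ := by
  ext x
  simp only [raise, Set.mem_insert_iff, Set.mem_sdiff, Set.mem_singleton_iff, Set.mem_compl_iff]
  grind

theorem WordEdge.dual {m i : ℕ} {u v : ℕ → Set ℕ} (h : WordEdge m i u v) :
    WordEdge m i (dual m v) (dual m u) := by
  obtain ⟨p, hp, hl, rfl⟩ := h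
  refine ⟨m - 1 - p, by omega, ⟨by omega, fun x hx => ?_⟩, funext fun x => ?_⟩
  · rw [height_dual _ _ hx, height_dual _ _ (by omega), show m - (m - 1 - p) = p + 1 by omega]
    simp only [height_raise_self hp hl, hl.height_succ hp]
    have := hl.2 (m - x) (by omega)
    split_ifs <;> omega
  · by_cases hx : x = m - 1 - p
    · subst hx
      simp [raiseAt, PrincipalLattice.dual, show m - 1 - p < m by omega,
        show m - 1 - (m - 1 - p) = p by omega, raise_compl_raise (hl.mem hp).1 (hl.mem hp).2]
    · simp only [raiseAt, Function.update_of_ne hx, PrincipalLattice.dual]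
      by_cases hxm : x < m
      · rw [if_pos hxm, if_pos hxm, Function.update_of_ne (by omega)]
      · rw [if_neg hxm, if_neg hxm, Function.update_of_ne (by omega)]

theorem wordEdge_dual_left {m i : ℕ} {u v : ℕ → Set ℕ} (h : WordEdge m i (dual m u) v) :
    WordEdge m i (dual m v) u := by
  simpa only [dual_dual] using h.dual

theorem localCrystal_word (n m : ℕ) : LocalCrystal (Set.Icc 1 n)
    (fun i u v => i ∈ Set.Icc 1 n ∧ WordEdge m i u v) (wordT m) (wordH m) where
  color h := h.1
  func h h' := wordEdge_func h.2 h'.2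
  inj {i u u' v} h h' := by
    rw [← dual_dual m u, ← dual_dual m u', wordEdge_func h.2.dual h'.2.dual]
  t_nonneg := wordT_nonneg m
  h_nonneg := wordH_nonneg m
  exists_in {i v} hi h := by
    rw [← wordH_dual] at h
    obtain ⟨w, hw⟩ := exists_wordEdge_out h
    exact ⟨_, hi, wordEdge_dual_left hw⟩
  exists_out hi h := by
    obtain ⟨w, hw⟩ := exists_wordEdge_out h
    exact ⟨w, hi, hw⟩
  t_step h := wordEdge_t_step h.2
  h_step h := wordEdge_h_step h.2
  far h _ hij := wordEdge_far h.2 hij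
  neighb h _ hij := wordEdge_neighb h.2 hij
  square hij h h' hlab := by
    obtain ⟨h1, w, h2, h3⟩ := wordEdge_square hij h.2 h'.2 hlab
    exact ⟨h1, w, ⟨h'.1, h2⟩, ⟨h.1, h3⟩⟩
  square_inv {i j u u' v} hij h h' hlab := by
    obtain ⟨h1, w, h2, h3⟩ := wordEdge_square hij h.2.dual h'.2.dual (by
      rw [wordT_dual, wordT_dual]
      rcases wordEdge_neighb h.2 hij with k | k <;> omega)
    rw [wordT_dual, wordT_dual] at h1
    refine ⟨?_, _, ⟨h'.1, wordEdge_dual_left h2⟩, ⟨h.1, wordEdge_dual_left h3⟩⟩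
    rcases wordEdge_neighb h'.2 hij.symm with k | k <;> omega
  verma hij h h' hlab hlab' := by
    obtain ⟨x₁, x₂, y₁, y₂, z, ⟨a₁, a₂, a₃⟩, b₁, b₂, b₃⟩ :=
      wordEdge_verma hij h.2 h'.2 hlab hlab'
    exact ⟨x₁, x₂, y₁, y₂, z, ⟨⟨h'.1, a₁⟩, ⟨h'.1, a₂⟩, ⟨h.1, a₃⟩⟩, ⟨h.1, b₁⟩, ⟨h.1, b₂⟩, h'.1, b₃⟩
  verma_inv {i j u u' v} hij h h' hlab hlab' := by
    obtain ⟨x₁, x₂, y₁, y₂, z, ⟨a₁, a₂, a₃⟩, b₁, b₂, b₃⟩ :=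
      wordEdge_verma hij h.2.dual h'.2.dual
        (by rw [wordT_dual, wordT_dual]; rcases wordEdge_neighb h.2 hij with k | k <;> omega)
        (by rw [wordT_dual, wordT_dual]; rcases wordEdge_neighb h'.2 hij.symm with k | k <;> omega)
    exact ⟨_, _, _, _, _,
      ⟨⟨h'.1, wordEdge_dual_left a₁⟩, ⟨h'.1, a₂.dual⟩, ⟨h.1, a₃.dual⟩⟩,
      ⟨h.1, wordEdge_dual_left b₁⟩, ⟨h.1, b₂.dual⟩, h'.1, b₃.dual⟩
  far_square hij h h' := by
    obtain ⟨w, h2, h3⟩ := wordEdge_far_square hij h.2 h'.2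
    exact ⟨w, ⟨h'.1, h2⟩, ⟨h.1, h3⟩⟩
  far_square_inv hij h h' := by
    obtain ⟨w, h2, h3⟩ := wordEdge_far_square hij h.2.dual h'.2.dual
    exact ⟨_, ⟨h'.1, wordEdge_dual_left h2⟩, ⟨h.1, wordEdge_dual_left h3⟩⟩

theorem height_le_of_nonneg {i : ℕ} {w : ℕ → Set ℕ} {x y : ℕ} (hxy : x ≤ y)
    (h : ∀ q, x ≤ q → q < y → 0 ≤ pairing i (w q)) : height i w x ≤ height i w y := by
  induction y, hxy using Nat.le_induction with
  | base => exact le_rfl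
  | succ y hy ih =>
    have h1 := ih fun q hq hqy => h q hq (by omega)
    have h2 := h y hy (by omega)
    rw [height_succ]
    omega

theorem height_le_of_nonpos {i : ℕ} {w : ℕ → Set ℕ} {x y : ℕ} (hxy : x ≤ y)
    (h : ∀ q, x ≤ q → q < y → pairing i (w q) ≤ 0) : height i w y ≤ height i w x := by
  induction y, hxy using Nat.le_induction with
  | base => exact le_rfl
  | succ y hy ih =>
    have h1 := ih fun q hq hqy => h q hq (by omega)
    have h2 := h y hy (by omega)
    rw [height_succ]
    omega

theorem wordEdge_of_signs {m i r : ℕ} {w : ℕ → Set ℕ} (hr : r < m) (h1 : i ∈ w r)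
    (h2 : i + 1 ∉ w r) (hlo : ∀ q < r, pairing i (w q) ≤ 0)
    (hhi : ∀ q, r < q → q < m → 0 ≤ pairing i (w q)) : WordEdge m i w (raiseAt i r w) := by
  have h3 : height i w (r + 1) = height i w r + 1 := by
    rw [height_succ, pairing, if_pos h1, if_neg h2, sub_zero]
  refine ⟨r, hr, ⟨hr.le, fun x hx => ?_⟩, rfl⟩
  rcases Nat.lt_or_ge r x with hrx | hrx
  · have := height_le_of_nonneg (w := w) (i := i) (show r + 1 ≤ x by omega)
      fun q hq hqx => hhi q (by omega) (by omega)
    omega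
  · have := height_le_of_nonpos (w := w) (i := i) hrx fun q _ hq => hlo q hq
    omega

/-- The edges of the crystal of a single column, with colors `1, …, n`. -/
def ColumnEdge (n i : ℕ) (A B : Set ℕ) : Prop :=
  i ∈ Set.Icc 1 n ∧ i ∈ A ∧ i + 1 ∉ A ∧ B = raise i A

theorem path_update {n m r : ℕ} {w : ℕ → Set ℕ} (hr : r < m)
    (hlo : ∀ i ∈ Set.Icc 1 n, ∀ q < r, pairing i (w q) ≤ 0)
    (hhi : ∀ i ∈ Set.Icc 1 n, ∀ q, r < q → q < m → 0 ≤ pairing i (w q)) {L : List ℕ}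
    {A B : Set ℕ} (hp : Path (ColumnEdge n) L A B) :
    Path (fun i u v => i ∈ Set.Icc 1 n ∧ WordEdge m i u v) L
      (Function.update w r A) (Function.update w r B) := by
  induction L generalizing A with
  | nil => cases hp; rfl
  | cons i L ih =>
    obtain ⟨D, ⟨hi, h1, h2, rfl⟩, hp⟩ := hp
    refine ⟨_, ⟨hi, ?_⟩, ih hp⟩
    have := wordEdge_of_signs (w := Function.update w r A) (i := i) hr (by simpa using h1)
      (by simpa using h2)
      (fun q hq => by rw [Function.update_of_ne (by omega)]; exact hlo i hi q hq)
      (fun q hq hqm => by rw [Function.update_of_ne (by omega)]; exact hhi i hi q hq hqm)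
    simpa [raiseAt] using this

theorem path_wStr {n k j : ℕ} (hj : 1 ≤ j) (hjk : j + k ≤ n + 1) :
    Path (ColumnEdge n) (wStr 0 k j) (Set.Ico j (j + k)) (Set.Ico (j + 1) (j + 1 + k)) := by
  have key : ∀ e ≤ k, Path (ColumnEdge n) ((List.range e).map fun m => 0 + j + k - 1 - m)
      (Set.Ico j (j + k)) (Set.Ico j (j + k - e) ∪ Set.Ico (j + k - e + 1) (j + k + 1)) := by
    intro e
    induction e with
    | zero => intro _; simp [Path]
    | succ e ih =>
      intro he
      rw [List.range_succ, List.map_append]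
      refine (ih (by omega)).append ⟨_, ⟨?_, ?_, ?_, rfl⟩, ?_⟩
      · simp only [Set.mem_Icc]; omega
      · simp only [Set.mem_union, Set.mem_Ico]; omega
      · simp only [Set.mem_union, Set.mem_Ico]; omega
      · show raise _ _ = _
        ext x
        simp only [raise, Set.mem_insert_iff, Set.mem_sdiff, Set.mem_singleton_iff, Set.mem_union,
          Set.mem_Ico]
        omega
  have h := key k le_rfl
  rwa [show Set.Ico j (j + k - k) ∪ Set.Ico (j + k - k + 1) (j + k + 1) =
    Set.Ico (j + 1) (j + 1 + k) by
      ext x; simp only [Set.mem_union, Set.mem_Ico]; omega] at h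

theorem path_SStr {n k : ℕ} (hk : k ≤ n) :
    Path (ColumnEdge n) (SStr 0 n k) (Set.Ico 1 (1 + k)) (Set.Ico (n - k + 2) (n + 2)) := by
  have key : ∀ e ≤ n - k + 1, Path (ColumnEdge n)
      ((List.range e).flatMap fun jm => wStr 0 k (jm + 1))
      (Set.Ico 1 (1 + k)) (Set.Ico (e + 1) (e + 1 + k)) := by
    intro e
    induction e with
    | zero => intro _; simp [Path]
    | succ e ih =>
      intro he
      rw [List.range_succ, List.flatMap_append, List.flatMap_singleton]
      exact (ih (by omega)).append (path_wStr (by omega) (by omega))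
  have h := key _ le_rfl
  rwa [show n - k + 1 + 1 + k = n + 2 by omega] at h

theorem pairing_high {i : ℕ} (hi : 1 ≤ i) (k : ℕ) :
    pairing i (Set.Ico 1 (1 + k)) = if k = i then 1 else 0 := by
  simp only [pairing, Set.mem_Ico]
  split_ifs <;> omega

theorem pairing_low_nonpos {i n : ℕ} (hi : i ≤ n) (k : ℕ) :
    pairing i (Set.Ico (n - k + 2) (n + 2)) ≤ 0 := by
  simp only [pairing, Set.mem_Ico]
  split_ifs <;> omega

/-- The word whose columns have the heights listed in `l`, the first `r` columns being lowest
and the others highest. -/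
def stageWord (n : ℕ) (l : List ℕ) (r : ℕ) : ℕ → Set ℕ := fun q =>
  if q < r then Set.Ico (n - l.getD q 0 + 2) (n + 2) else Set.Ico 1 (1 + l.getD q 0)

theorem path_stageWord {n : ℕ} {l : List ℕ} (hl : ∀ k ∈ l, k ≤ n) :
    Path (fun i u v => i ∈ Set.Icc 1 n ∧ WordEdge l.length i u v) (l.flatMap (SStr 0 n))
      (stageWord n l 0) (stageWord n l l.length) := by
  have key : ∀ r ≤ l.length, Path (fun i u v => i ∈ Set.Icc 1 n ∧ WordEdge l.length i u v)
      ((l.take r).flatMap (SStr 0 n)) (stageWord n l 0) (stageWord n l r) := by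
    intro r
    induction r with
    | zero => intro _; simp [Path]
    | succ r ih =>
      intro hr
      rw [← List.take_append_getElem hr, List.flatMap_append, List.flatMap_singleton]
      refine (ih (by omega)).append ?_
      have hp := path_update (w := stageWord n l r) (m := l.length) hr
        (fun i hi q hq => by
          rw [stageWord, if_pos hq]
          exact pairing_low_nonpos hi.2 _)
        (fun i hi q hq _ => by
          rw [stageWord, if_neg (by omega), pairing_high hi.1]
          split_ifs <;> simp)
        (path_SStr (hl _ (List.getElem_mem hr)))
      have e1 : Function.update (stageWord n l r) r (Set.Ico 1 (1 + l[r])) = stageWord n l r := by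
        rw [Function.update_eq_self_iff, stageWord, if_neg (lt_irrefl r),
          List.getD_eq_getElem _ _ hr]
      have e2 : Function.update (stageWord n l r) r (Set.Ico (n - l[r] + 2) (n + 2)) =
          stageWord n l (r + 1) := by
        funext q
        by_cases hq : q = r
        · subst hq
          rw [Function.update_self, stageWord, if_pos (by omega), List.getD_eq_getElem _ _ hr]
        · rw [Function.update_of_ne hq, stageWord, stageWord]
          simp only [show q < r + 1 ↔ q < r by omega]
      rwa [e1, e2] at hp
  simpa using key _ le_rfl

theorem height_stageWord_zero {n i : ℕ} (hi : 1 ≤ i) (l : List ℕ) {x : ℕ} (hx : x ≤ l.length) :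
    height i (stageWord n l 0) x = ((l.take x).count i : ℤ) := by
  induction x with
  | zero => simp [height_zero]
  | succ x ih =>
    rw [height_succ, ih (by omega), ← List.take_append_getElem hx, List.count_append, stageWord,
      if_neg (by omega), pairing_high hi, List.getD_eq_getElem _ _ hx, List.count_singleton]
    simp

theorem minOn_stageWord_zero {n i : ℕ} (hi : 1 ≤ i) (l : List ℕ) :
    minOn l.length (height i (stageWord n l 0)) = 0 := by
  rw [minOn_eq (p := 0) (by omega), height_zero]
  intro x hx
  rw [height_zero, height_stageWord_zero hi l hx]
  omega

theorem wordT_stageWord_zero {n i : ℕ} (hi : 1 ≤ i) (l : List ℕ) :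
    wordT l.length i (stageWord n l 0) = 0 := by
  rw [wordT, minOn_stageWord_zero hi, neg_zero]

theorem wordH_stageWord_zero {n i : ℕ} (hi : 1 ≤ i) (l : List ℕ) :
    wordH l.length i (stageWord n l 0) = (l.count i : ℤ) := by
  rw [wordH, minOn_stageWord_zero hi, height_stageWord_zero hi l le_rfl, List.take_length, sub_zero]

theorem wordH_stageWord_length {n i : ℕ} (hi : i ≤ n) (l : List ℕ) :
    wordH l.length i (stageWord n l l.length) = 0 := by
  rw [wordH, minOn_eq le_rfl, sub_self]
  refine fun x hx => height_le_of_nonpos hx fun q _ hq => ?_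
  rw [stageWord, if_pos hq]
  exact pairing_low_nonpos hi _

end Words

theorem exists_applyStr_eq {n : ℕ} {K : PreGraph} (hK : IsACrystal n K) {s : K.V}
    (hs : IsSource K s) {l l' : List ℕ} (hl : ∀ k ∈ l, k ≤ n) (hperm : l.Perm l')
    (hcount : ∀ i ∈ Set.Icc 1 n, l.count i ≤ K.h i s) :
    ∃ v, applyStr K (l.flatMap (SStr 0 n)) s = some v ∧
      applyStr K (l'.flatMap (SStr 0 n)) s = some v := by
  have hl' : ∀ k ∈ l', k ≤ n := fun k hk => hl k (hperm.mem_iff.2 hk)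
  have hts : ∀ i ∈ Set.Icc 1 n, (K.t i s : ℤ) = 0 := by
    intro i _
    by_contra h
    obtain ⟨u, hu⟩ := exists_in_of_t_pos hK.1 (i := i) (v := s) (by omega)
    exact hs i u hu
  obtain ⟨v, h1, h2⟩ := path_ends_eq (localCrystal_word n l.length)
    (localCrystal_word n l'.length) (localCrystal_of_isCrystalOn hK)
    (fun i hi => wordT_stageWord_zero hi.1 l) (fun i hi => wordT_stageWord_zero hi.1 l')
    hts
    (fun i hi => by rw [wordH_stageWord_zero hi.1, wordH_stageWord_zero hi.1, hperm.count_eq])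
    (fun i hi => by rw [wordH_stageWord_zero hi.1]; exact_mod_cast hcount i hi)
    (hperm.flatMap_right (SStr 0 n)).length_eq (path_stageWord hl) (path_stageWord hl')
    (fun i hi => wordH_stageWord_length hi.2 l) (fun i hi => wordH_stageWord_length hi.2 l')
  exact ⟨v, path_iff_applyStr.1 h1, path_iff_applyStr.1 h2⟩

/-- The colors `k` of the strings `S_{n,k}` composing the principal string with exponents `a`. -/
def principalColors (n : ℕ) (a : ℕ → ℕ) : List ℕ :=
  (List.range n).flatMap fun km => List.replicate (a (km + 1)) (km + 1)

theorem prinStr_eq_flatMap (n : ℕ) (a : ℕ → ℕ) :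
    prinStr 0 n a = (principalColors n a).flatMap (SStr 0 n) := by
  rw [prinStr, principalColors, List.flatMap_assoc]
  congr 1
  funext km
  rw [List.flatMap, List.map_replicate, Nat.zero_add]

theorem mem_principalColors {n k : ℕ} {a : ℕ → ℕ} (h : k ∈ principalColors n a) :
    1 ≤ k ∧ k ≤ n := by
  simp only [principalColors, List.mem_flatMap, List.mem_range, List.mem_replicate] at h
  omega

theorem count_principalColors (n k : ℕ) (a : ℕ → ℕ) :
    (principalColors n a).count k = if 1 ≤ k ∧ k ≤ n then a k else 0 := by
  induction n with
  | zero => rw [if_neg (by omega)]; simp [principalColors]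
  | succ n ih =>
    rw [principalColors] at ih ⊢
    rw [List.range_succ, List.flatMap_append, List.flatMap_singleton, List.count_append, ih,
      List.count_replicate]
    by_cases hk : k = n + 1
    · subst hk; simp
    · simp only [beq_iff_eq, Ne.symm hk, if_false, add_zero]
      congr 1
      apply propext
      omega

theorem applyStr_append (K : PreGraph) (L L' : List ℕ) (v : K.V) :
    applyStr K (L ++ L') v = (applyStr K L v).bind (applyStr K L') := by
  induction L generalizing v with
  | nil => rfl
  | cons i L ih =>
    simp only [List.cons_append, applyStr]
    cases K.F i v with
    | none => rfl
    | some w => exact ih w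

end PrincipalLattice

/-- In the `A_n`-crystal `K(c)` with source `s`, for `0 ≤ a ≤ c` every
operator in the string `S_{n,n}^{a_n} ⋯ S_{n,1}^{a_1}` acts when applied to `s` (so the
principal vertex `v[a]` is well defined); the strings `S_{n,k}` commute on the principal
lattice; and `v[a + 1_k] = S_{n,k}(v[a])` whenever `a + 1_k ≤ c`. -/
theorem principal_strings_act_and_commute
    (n : ℕ) (K : PreGraph) (hK : IsACrystal n K)
    (s : K.V) (hs : IsSource K s)
    (c : ℕ → ℕ) (hc : ∀ i, 1 ≤ i → i ≤ n → K.h i s = c i)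
    (a : ℕ → ℕ) (ha : ∀ i, 1 ≤ i → i ≤ n → a i ≤ c i) :
    (prinOpt K 0 n s a).isSome ∧
    (∀ k k', 1 ≤ k → k ≤ n → 1 ≤ k' → k' ≤ n →
      (∀ i, 1 ≤ i → i ≤ n →
        a i + (if i = k then 1 else 0) + (if i = k' then 1 else 0) ≤ c i) →
      ∀ v : K.V, prinOpt K 0 n s a = some v →
        ((applyStr K (SStr 0 n k') v).bind (applyStr K (SStr 0 n k))).isSome ∧
        (applyStr K (SStr 0 n k') v).bind (applyStr K (SStr 0 n k)) =
          (applyStr K (SStr 0 n k) v).bind (applyStr K (SStr 0 n k'))) ∧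
    (∀ k, 1 ≤ k → k ≤ n →
      (∀ i, 1 ≤ i → i ≤ n → a i + (if i = k then 1 else 0) ≤ c i) →
      prinOpt K 0 n s (fun i => if i = k then a i + 1 else a i) =
        (prinOpt K 0 n s a).bind (applyStr K (SStr 0 n k))) := by
  have hmem : ∀ k ∈ PrincipalLattice.principalColors n a, k ≤ n := fun k hk =>
    (PrincipalLattice.mem_principalColors hk).2
  have hcount : ∀ i, 1 ≤ i → i ≤ n → (PrincipalLattice.principalColors n a).count i = a i :=
    fun i hi hin => by rw [PrincipalLattice.count_principalColors, if_pos ⟨hi, hin⟩]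
  simp only [prinOpt, PrincipalLattice.prinStr_eq_flatMap]
  refine ⟨?_, fun k k' hk hkn hk' hkn' hle v hv => ?_, fun k hk hkn hle => ?_⟩
  · obtain ⟨v, hv, -⟩ := PrincipalLattice.exists_applyStr_eq hK hs hmem (List.Perm.refl _)
      fun i hi => by rw [hcount i hi.1 hi.2, hc i hi.1 hi.2]; exact ha i hi.1 hi.2
    rw [hv]
    rfl
  · obtain ⟨v', h1, h2⟩ := PrincipalLattice.exists_applyStr_eq hK hs
      (l := PrincipalLattice.principalColors n a ++ [k', k])
      (l' := PrincipalLattice.principalColors n a ++ [k, k'])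
      (fun x hx => by
        rcases List.mem_append.1 hx with hx | hx
        · exact hmem x hx
        · simp only [List.mem_cons, List.not_mem_nil, or_false] at hx
          rcases hx with rfl | rfl <;> assumption)
      ((List.Perm.swap _ _ _).append_left _)
      (fun i hi => by
        rw [List.count_append, hcount i hi.1 hi.2, hc i hi.1 hi.2]
        refine le_trans (le_of_eq ?_) (hle i hi.1 hi.2)
        simp only [List.count_cons, List.count_nil, beq_iff_eq, @eq_comm _ i]
        ring)
    simp only [List.flatMap_append, List.flatMap_cons, List.flatMap_nil, List.append_nil,
      PrincipalLattice.applyStr_append, hv, Option.bind_some] at h1 h2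
    exact ⟨by rw [h1]; rfl, h1.trans h2.symm⟩
  · obtain ⟨v', h1, h2⟩ := PrincipalLattice.exists_applyStr_eq hK hs
      (l := PrincipalLattice.principalColors n a ++ [k])
      (l' := PrincipalLattice.principalColors n (fun i => if i = k then a i + 1 else a i))
      (fun x hx => by
        rcases List.mem_append.1 hx with hx | hx
        · exact hmem x hx
        · rw [List.mem_singleton.1 hx]
          exact hkn)
      (List.perm_iff_count.2 fun i => by
        rw [List.count_append, PrincipalLattice.count_principalColors,
          PrincipalLattice.count_principalColors, List.count_singleton]
        by_cases hik : i = k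
        · subst hik; simp [hk, hkn]
        · simp [hik, Ne.symm hik])
      (fun i hi => by
        rw [List.count_append, hcount i hi.1 hi.2, hc i hi.1 hi.2]
        refine le_trans (le_of_eq ?_) (hle i hi.1 hi.2)
        simp only [List.count_singleton, beq_iff_eq, @eq_comm _ i])
    rw [h2, ← h1, List.flatMap_append, PrincipalLattice.applyStr_append, List.flatMap_singleton]
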